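/- Let α be an irrational number for which there exists 0 < δ < 1 with β_δ(α) := limsup_{n→∞} (log q_{n+1})/q_n^δ < ∞ (α is Brjuno in the sense of this paper). Then the Lyapunov exponent is discontinuous at some point of C^∞(S¹, SL(2,ℝ)) in the C^∞ topology: there exist D ∈ C^∞(S¹, SL(2,ℝ)) with L(α,D) > 0 and a sequence A_j ∈ C^∞(S¹, SL(2,ℝ)) such that for every k ∈ ℕ, ‖A_j − D‖_{C^k} → 0 as j → ∞, but limsup_{j→∞} L(α, A_j) < L(α, D). -/

import Mathlib

open Filter MeasureTheory

noncomputable section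

attribute [local instance] Matrix.normedAddCommGroup Matrix.normedSpace

/-- The Euclidean operator norm of a 2×2 real matrix. -/
def opNorm (M : Matrix (Fin 2) (Fin 2) ℝ) : ℝ :=
  ‖Matrix.toEuclideanCLM (𝕜 := ℝ) M‖

/-- The iterated cocycle `A^n(x) = A(x + (n-1)α) ⋯ A(x + α) A(x)` over the rotation by `α`. -/
def cocIter (α : ℝ) (A : ℝ → Matrix (Fin 2) (Fin 2) ℝ) :
    ℕ → ℝ → Matrix (Fin 2) (Fin 2) ℝ
  | 0, _ => 1
  | n + 1, x => A (x + (n : ℝ) * α) * cocIter α A n x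

/-- The Lyapunov exponent `L(α, A) = lim_n (1/n) ∫_{S¹} log ‖A^n(x)‖ dx` (the limit exists by
subadditivity, so it agrees with the `limsup` used here). -/
def lyap (α : ℝ) (A : ℝ → Matrix (Fin 2) (Fin 2) ℝ) : ℝ :=
  limsup (fun n : ℕ =>
    (n : ℝ)⁻¹ * ∫ x in (0 : ℝ)..1, Real.log (opNorm (cocIter α A n x))) atTop

/-- The `C^l` norm `max_{0 ≤ k ≤ l} sup_x ‖∂^k A(x)‖` of a matrix-valued map on the circle. -/
def cNorm (l : ℕ) (A : ℝ → Matrix (Fin 2) (Fin 2) ℝ) : ℝ :=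
  ⨆ k : Fin (l + 1), ⨆ x : ℝ, ‖iteratedDeriv (k : ℕ) A x‖

/-- Gauss map iterates of `α`: `x₀ = {α}`, `x_{n+1} = {1/x_n}`. -/
def gaussIter (α : ℝ) : ℕ → ℝ
  | 0 => Int.fract α
  | n + 1 => Int.fract (gaussIter α n)⁻¹

/-- `cfa α n` is the partial quotient `a_{n+1} = ⌊1/x_n⌋` of the continued fraction of `α`. -/
def cfa (α : ℝ) (n : ℕ) : ℕ := ⌊(gaussIter α n)⁻¹⌋₊

/-- Denominators `q_n` of the continued fraction convergents of `α`:
`q₀ = 1`, `q₁ = a₁`, `q_{n+2} = a_{n+2} q_{n+1} + q_n`. -/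
def cfq (α : ℝ) : ℕ → ℕ
  | 0 => 1
  | 1 => cfa α 0
  | n + 2 => cfa α (n + 1) * cfq α (n + 1) + cfq α n


lemma opNorm_mul_le (A B : Matrix (Fin 2) (Fin 2) ℝ) : opNorm (A * B) ≤ opNorm A * opNorm B := by
  unfold opNorm; rw [map_mul]; exact norm_mul_le _ _

lemma opNorm_nonneg (A : Matrix (Fin 2) (Fin 2) ℝ) : 0 ≤ opNorm A := norm_nonneg _

lemma abs_entry_le (M : Matrix (Fin 2) (Fin 2) ℝ) (i j : Fin 2) : |M i j| ≤ opNorm M := by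
  have h1 := (Matrix.toEuclideanCLM (𝕜 := ℝ) M).le_opNorm (EuclideanSpace.single j 1)
  have h2 := PiLp.norm_apply_le (Matrix.toEuclideanCLM (𝕜 := ℝ) M (EuclideanSpace.single j 1)) i
  have h3 : (Matrix.toEuclideanCLM (𝕜 := ℝ) M (EuclideanSpace.single j 1)) i = M i j := by
    rw [Matrix.ofLp_toEuclideanCLM]; simp
  rw [h3] at h2
  simp at h1
  simpa [opNorm] using h2.trans h1

lemma opNorm_le (M : Matrix (Fin 2) (Fin 2) ℝ) :
    opNorm M ≤ |M 0 0| + |M 0 1| + |M 1 0| + |M 1 1| := by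
  unfold opNorm
  refine ContinuousLinearMap.opNorm_le_bound _ (by positivity) fun x => ?_
  have hx0 := PiLp.norm_apply_le x 0
  have hx1 := PiLp.norm_apply_le x 1
  rw [Real.norm_eq_abs] at hx0 hx1
  have key : ∀ y : EuclideanSpace ℝ (Fin 2), ‖y‖ ≤ |y 0| + |y 1| := by
    intro y
    rw [EuclideanSpace.norm_eq, Fin.sum_univ_two]
    refine Real.sqrt_le_iff.2 ⟨by positivity, ?_⟩
    rw [Real.norm_eq_abs, Real.norm_eq_abs]
    nlinarith [abs_nonneg (y 0), abs_nonneg (y 1)]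
  refine (key _).trans ?_
  rw [Matrix.ofLp_toEuclideanCLM]
  simp only [Matrix.mulVec, dotProduct, Fin.sum_univ_two]
  have e0 := abs_add_le (M 0 0 * x 0) (M 0 1 * x 1)
  have e1 := abs_add_le (M 1 0 * x 0) (M 1 1 * x 1)
  simp only [abs_mul] at e0 e1
  have := mul_le_mul_of_nonneg_left hx0 (abs_nonneg (M 0 0))
  have := mul_le_mul_of_nonneg_left hx1 (abs_nonneg (M 0 1))
  have := mul_le_mul_of_nonneg_left hx0 (abs_nonneg (M 1 0))
  have := mul_le_mul_of_nonneg_left hx1 (abs_nonneg (M 1 1))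
  linarith

lemma half_le_opNorm (M : Matrix (Fin 2) (Fin 2) ℝ) (h : M.det = 1) : 1 / 2 ≤ opNorm M := by
  rw [Matrix.det_fin_two] at h
  have h0 := opNorm_nonneg M
  have a := abs_entry_le M 0 0
  have b := abs_entry_le M 0 1
  have c := abs_entry_le M 1 0
  have d := abs_entry_le M 1 1
  have e1 : |M 0 0 * M 1 1| ≤ opNorm M * opNorm M := by
    rw [abs_mul]; exact mul_le_mul a d (abs_nonneg _) h0
  have e2 : |M 0 1 * M 1 0| ≤ opNorm M * opNorm M := by
    rw [abs_mul]; exact mul_le_mul b c (abs_nonneg _) h0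
  by_contra hc
  push Not at hc
  have := abs_le.1 e1
  have := abs_le.1 e2
  nlinarith

lemma neg_one_le_log (M : Matrix (Fin 2) (Fin 2) ℝ) (h : M.det = 1) :
    -1 ≤ Real.log (opNorm M) := by
  have h1 := half_le_opNorm M h
  have h2 := Real.log_le_log (by norm_num) h1
  have h3 : Real.log (1/2) = - Real.log 2 := by rw [one_div, Real.log_inv]
  have := Real.log_two_lt_d9
  linarith

lemma opNorm_continuous : Continuous opNorm := by
  unfold opNorm
  have : Continuous (Matrix.toEuclideanCLM (n := Fin 2) (𝕜 := ℝ)) :=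
    LinearMap.continuous_of_finiteDimensional
      (Matrix.toEuclideanCLM (n := Fin 2) (𝕜 := ℝ)).toAlgEquiv.toLinearMap
  exact this.norm

/-- A continuous periodic SL(2) cocycle map. -/
structure Coc (A : ℝ → Matrix (Fin 2) (Fin 2) ℝ) : Prop where
  per : Function.Periodic A 1
  cont : Continuous A
  det : ∀ x, (A x).det = 1

section
variable {α : ℝ} {A : ℝ → Matrix (Fin 2) (Fin 2) ℝ}

lemma cocIter_add (m n : ℕ) (x : ℝ) :
    cocIter α A (m + n) x = cocIter α A n (x + m * α) * cocIter α A m x := by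
  induction n with
  | zero => simp [cocIter]
  | succ n ih =>
    rw [← add_assoc, cocIter, ih, cocIter, Matrix.mul_assoc]
    congr 2
    push_cast; ring

lemma cocIter_cont (h : Coc A) (n : ℕ) : Continuous (cocIter α A n) := by
  induction n with
  | zero => exact continuous_const
  | succ n ih =>
    have : Continuous fun x => A (x + (n : ℝ) * α) := h.cont.comp (by fun_prop)
    exact this.matrix_mul ih

lemma cocIter_det (h : Coc A) (n : ℕ) (x : ℝ) : (cocIter α A n x).det = 1 := by
  induction n with
  | zero => simp [cocIter]
  | succ n ih => rw [cocIter, Matrix.det_mul, ih, h.det, one_mul]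

lemma cocIter_per (h : Coc A) (n : ℕ) : Function.Periodic (cocIter α A n) 1 := by
  induction n with
  | zero => intro x; rfl
  | succ n ih =>
    intro x
    rw [cocIter, cocIter, ih, show x + 1 + (n : ℝ) * α = (x + n * α) + 1 by ring, h.per]

/-- log norm integral -/
def lint (α : ℝ) (A : ℝ → Matrix (Fin 2) (Fin 2) ℝ) (n : ℕ) : ℝ :=
  ∫ x in (0 : ℝ)..1, Real.log (opNorm (cocIter α A n x))

lemma logc_cont (h : Coc A) (n : ℕ) :
    Continuous fun x => Real.log (opNorm (cocIter α A n x)) := by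
  refine (opNorm_continuous.comp (cocIter_cont h n)).log fun x => ?_
  have := half_le_opNorm _ (cocIter_det (α := α) h n x)
  simp only [Function.comp]
  linarith

lemma int_shift {f : ℝ → ℝ} (hf : Function.Periodic f 1) (t : ℝ) :
    ∫ x in (0 : ℝ)..1, f (x + t) = ∫ x in (0 : ℝ)..1, f x := by
  rw [intervalIntegral.integral_comp_add_right]
  have := hf.intervalIntegral_add_eq t 0
  simpa [add_comm] using this

lemma cont_shift {f : ℝ → ℝ} (hf : Continuous f) (t : ℝ) : Continuous fun x => f (x + t) :=
  hf.comp (continuous_id.add continuous_const)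

lemma lint_subadd (h : Coc A) : Subadditive (lint α A) := by
  intro m n
  unfold lint
  have c1 := logc_cont (α := α) h n
  have c2 := logc_cont (α := α) h m
  have c3 := logc_cont (α := α) h (m + n)
  have hp : Function.Periodic (fun x => Real.log (opNorm (cocIter α A n x))) 1 := by
    intro x; simp only [cocIter_per h n x]
  have c4 := cont_shift c1 (m * α)
  have key : ∀ x, Real.log (opNorm (cocIter α A (m + n) x)) ≤
      Real.log (opNorm (cocIter α A m x)) + Real.log (opNorm (cocIter α A n (x + m * α))) := by
    intro x
    have a := half_le_opNorm _ (cocIter_det (α := α) h n (x + m * α))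
    have b := half_le_opNorm _ (cocIter_det (α := α) h m x)
    have c := half_le_opNorm _ (cocIter_det (α := α) h (m + n) x)
    rw [← Real.log_mul (by linarith) (by linarith), mul_comm]
    refine Real.log_le_log (by linarith) ?_
    rw [cocIter_add]
    exact opNorm_mul_le _ _
  calc _ ≤ ∫ x in (0 : ℝ)..1, (Real.log (opNorm (cocIter α A m x)) +
          Real.log (opNorm (cocIter α A n (x + m * α)))) :=
        intervalIntegral.integral_mono (by norm_num) (c3.intervalIntegrable _ _)
          ((c2.add c4).intervalIntegrable _ _) key
    _ = _ := by
        rw [intervalIntegral.integral_add (c2.intervalIntegrable _ _) (c4.intervalIntegrable _ _)]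
        congr 1
        exact int_shift hp (m * α)

lemma lint_ge (h : Coc A) (n : ℕ) : -1 ≤ lint α A n := by
  unfold lint
  have := intervalIntegral.integral_mono (a := 0) (b := 1) (μ := volume) (f := fun _ => (-1 : ℝ))
    (g := fun x => Real.log (opNorm (cocIter α A n x))) (by norm_num) (by simp)
    ((logc_cont h _).intervalIntegrable _ _) (fun x => neg_one_le_log _ (cocIter_det h n x))
  simpa using this

lemma lint_bdd (h : Coc A) : BddBelow (Set.range fun n => lint α A n / n) := by
  refine ⟨-1, ?_⟩
  rintro _ ⟨n, rfl⟩
  simp only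
  rcases Nat.eq_zero_or_pos n with rfl | hn
  · simp
  · have : (1 : ℝ) ≤ n := by exact_mod_cast hn
    rw [le_div_iff₀ (by linarith)]
    have := lint_ge (α := α) h n
    linarith

lemma lyap_eq (h : Coc A) : lyap α A = (lint_subadd (α := α) h).lim := by
  have := (lint_subadd (α := α) h).tendsto_lim (lint_bdd h)
  unfold lyap
  refine Tendsto.limsup_eq ?_
  refine this.congr fun n => ?_
  rw [div_eq_inv_mul]; rfl

lemma lyap_le (h : Coc A) {n : ℕ} (hn : n ≠ 0) : lyap α A ≤ lint α A n / n := by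
  rw [lyap_eq h]
  exact (lint_subadd (α := α) h).lim_le_div (lint_bdd h) hn

lemma le_lyap (h : Coc A) {c : ℝ} (hc : ∀ n : ℕ, n ≠ 0 → c ≤ lint α A n / n) :
    c ≤ lyap α A := by
  rw [lyap_eq h]
  refine ge_of_tendsto ((lint_subadd (α := α) h).tendsto_lim (lint_bdd h)) ?_
  filter_upwards [eventually_ne_atTop 0] with n hn using hc n hn

/-- lower bound up to constant gives exact bound at every time. -/
lemma le_lint_of_le (h : Coc A) {c C : ℝ} (hc : ∀ n : ℕ, n * c - C ≤ lint α A n) (n : ℕ)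
    (hn : n ≠ 0) : c ≤ lint α A n / n := by
  refine le_trans ?_ (((lint_subadd (α := α) h)).lim_le_div (lint_bdd h) hn)
  have t1 := (lint_subadd (α := α) h).tendsto_lim (lint_bdd h)
  have t2 : Tendsto (fun n : ℕ => c - C / n) atTop (nhds (c - 0)) :=
    tendsto_const_nhds.sub (tendsto_const_div_atTop_nhds_zero_nat C)
  rw [sub_zero] at t2
  refine le_of_tendsto_of_tendsto t2 t1 ?_
  filter_upwards [eventually_gt_atTop 0] with n hn
  have hn' : (0 : ℝ) < n := by exact_mod_cast hn
  rw [le_div_iff₀ hn', sub_mul, div_mul_cancel₀ _ hn'.ne']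
  linarith [hc n]

lemma neg_one_le_lyap (h : Coc A) : -1 ≤ lyap α A := by
  refine le_lyap h fun n hn => ?_
  have : (1 : ℝ) ≤ n := by exact_mod_cast Nat.pos_of_ne_zero hn
  rw [le_div_iff₀ (by linarith)]
  have := lint_ge (α := α) h n
  linarith

/-- upper semicontinuity in the form needed -/
lemma lyap_limit {Dn : ℕ → ℝ → Matrix (Fin 2) (Fin 2) ℝ} (hD : ∀ j, Coc (Dn j)) (h : Coc A)
    (hlim : ∀ x, Tendsto (fun j => Dn j x) atTop (nhds (A x)))
    (hbd : ∃ C : ℝ, 1 ≤ C ∧ ∀ j x, opNorm (Dn j x) ≤ C)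
    {c : ℝ} (hc : ∀ j, ∀ n : ℕ, n ≠ 0 → c ≤ lint α (Dn j) n / n) : c ≤ lyap α A := by
  refine le_lyap h fun n hn => ?_
  obtain ⟨C, hC1, hC⟩ := hbd
  have hit : ∀ n x, Tendsto (fun j => cocIter α (Dn j) n x) atTop (nhds (cocIter α A n x)) := by
    intro n x
    induction n with
    | zero => exact tendsto_const_nhds
    | succ n ih => exact (hlim _).mul ih
  have hit2 : ∀ n j x, opNorm (cocIter α (Dn j) n x) ≤ 2 * C ^ n := by
    intro n j x
    induction n with
    | zero =>
      simp only [cocIter]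
      refine (opNorm_le _).trans ?_
      norm_num
    | succ n ih =>
      rw [cocIter]
      refine (opNorm_mul_le _ _).trans ?_
      rw [pow_succ]
      have := mul_le_mul (hC j (x + n * α)) ih (opNorm_nonneg _) (by linarith)
      linarith
  have ht : Tendsto (fun j => lint α (Dn j) n) atTop (nhds (lint α A n)) := by
    unfold lint
    refine intervalIntegral.tendsto_integral_filter_of_dominated_convergence
      (fun _ => 1 + |Real.log (2 * C ^ n)|) ?_ ?_ ?_ ?_
    · exact Eventually.of_forall fun j => (logc_cont (hD j) n).aestronglyMeasurable
    · refine Eventually.of_forall fun j => Eventually.of_forall fun x _ => ?_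
      have h1 := neg_one_le_log _ (cocIter_det (α := α) (hD j) n x)
      have h2 := half_le_opNorm _ (cocIter_det (α := α) (hD j) n x)
      have h3 := Real.log_le_log (by linarith) (hit2 n j x)
      rw [Real.norm_eq_abs, abs_le]
      constructor
      · linarith [abs_nonneg (Real.log (2 * C ^ n))]
      · linarith [le_abs_self (Real.log (2 * C ^ n))]
    · simp
    · refine Eventually.of_forall fun x _ => ?_
      have h2 := half_le_opNorm _ (cocIter_det (α := α) h n x)
      exact ((opNorm_continuous.tendsto _).comp (hit n x)).log (by linarith)
  exact ge_of_tendsto (ht.div_const _) (Eventually.of_forall fun j => hc j n hn)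

end

section NT

def cfp (α : ℝ) : ℕ → ℤ
  | 0 => ⌊α⌋
  | 1 => cfa α 0 * ⌊α⌋ + 1
  | n + 2 => cfa α (n + 1) * cfp α (n + 1) + cfp α n

variable {α : ℝ}

lemma gauss_irr (hα : Irrational α) (n : ℕ) : Irrational (gaussIter α n) := by
  induction n with
  | zero =>
    have := hα.sub_intCast ⌊α⌋
    exact this
  | succ n ih =>
    have := (irrational_inv_iff.2 ih).sub_intCast ⌊(gaussIter α n)⁻¹⌋
    exact this

lemma gauss_pos (hα : Irrational α) (n : ℕ) : 0 < gaussIter α n := by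
  have h0 : 0 ≤ gaussIter α n := by cases n <;> exact Int.fract_nonneg _
  exact lt_of_le_of_ne h0 (gauss_irr hα n).ne_zero.symm

lemma gauss_lt (n : ℕ) : gaussIter α n < 1 := by
  cases n <;> exact Int.fract_lt_one _

lemma gauss_rec (hα : Irrational α) (n : ℕ) :
    gaussIter α n * (cfa α n + gaussIter α (n + 1)) = 1 := by
  have h := gauss_pos hα n
  have h1 : (cfa α n : ℝ) + gaussIter α (n + 1) = (gaussIter α n)⁻¹ := by
    rw [gaussIter, cfa, natCast_floor_eq_intCast_floor (by positivity)]
    exact Int.floor_add_fract _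
  rw [h1, mul_inv_cancel₀ h.ne']

lemma cfa_pos (hα : Irrational α) (n : ℕ) : 1 ≤ cfa α n := by
  rw [cfa, Nat.one_le_floor_iff]
  exact (one_le_inv₀ (gauss_pos hα n)).2 (gauss_lt n).le

lemma cfq_pos (hα : Irrational α) (n : ℕ) : 1 ≤ cfq α n ∧ 1 ≤ cfq α (n + 1) := by
  induction n with
  | zero => exact ⟨le_rfl, cfa_pos hα 0⟩
  | succ n ih =>
    refine ⟨ih.2, ?_⟩
    rw [cfq]; omega

lemma cfq_le (hα : Irrational α) (n : ℕ) : cfq α n ≤ cfq α (n + 1) := by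
  cases n with
  | zero => exact cfa_pos hα 0
  | succ n =>
    rw [show cfq α (n + 1 + 1) = cfa α (n + 1) * cfq α (n + 1) + cfq α n by rw [cfq]]
    have := cfa_pos hα (n + 1)
    nlinarith [cfq α (n + 1)]

lemma cfq_ge (hα : Irrational α) (n : ℕ) : n ≤ cfq α n := by
  induction n with
  | zero => exact Nat.zero_le _
  | succ n ih =>
    cases n with
    | zero => exact cfa_pos hα 0
    | succ n =>
      rw [show cfq α (n + 1 + 1) = cfa α (n + 1) * cfq α (n + 1) + cfq α n by rw [cfq]]
      have := cfa_pos hα (n + 1)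
      have := (cfq_pos hα n).1
      nlinarith

lemma cfd_rec (hα : Irrational α) (n : ℕ) :
    (cfq α (n + 1) * α - cfp α (n + 1) : ℝ) = - gaussIter α (n + 1) * (cfq α n * α - cfp α n) := by
  induction n with
  | zero =>
    have h := gauss_rec hα 0
    have h0 : gaussIter α 0 = α - ⌊α⌋ := rfl
    simp only [cfq, cfp, zero_add] at *
    push_cast
    rw [h0] at h
    linear_combination h
  | succ n ih =>
    have h := gauss_rec hα (n + 1)
    rw [show cfq α (n + 1 + 1) = cfa α (n + 1) * cfq α (n + 1) + cfq α n by rw [cfq],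
      show cfp α (n + 1 + 1) = cfa α (n + 1) * cfp α (n + 1) + cfp α n by rw [cfp]]
    push_cast
    have hx := gauss_pos hα (n + 1)
    set d := (cfq α n * α - cfp α n : ℝ)
    set d1 := (cfq α (n + 1) * α - cfp α (n + 1) : ℝ)
    have e : (cfa α (n + 1) * cfq α (n + 1) + cfq α n) * α -
      (cfa α (n + 1) * cfp α (n + 1) + cfp α n) = cfa α (n + 1) * d1 + d := by
      simp only [d, d1]; ring
    rw [e, ih]
    linear_combination (-d) * h

lemma cf_det (n : ℕ) :
    (cfq α n : ℤ) * cfp α (n + 1) - cfq α (n + 1) * cfp α n = (-1) ^ n := by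
  induction n with
  | zero => simp [cfq, cfp]
  | succ n ih =>
    rw [show cfq α (n + 1 + 1) = cfa α (n + 1) * cfq α (n + 1) + cfq α n by rw [cfq],
      show cfp α (n + 1 + 1) = cfa α (n + 1) * cfp α (n + 1) + cfp α n by rw [cfp]]
    push_cast
    rw [pow_succ]
    linear_combination (-1 : ℤ) * ih

lemma cf_sep (hα : Irrational α) (n l : ℕ) (hl : 0 < l) (hl2 : l < cfq α (n + 1)) (p : ℤ) :
    1 / (2 * (cfq α (n + 1) : ℝ)) ≤ |l * α - p| := by
  have hdet := cf_det (α := α) n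
  have hrec := cfd_rec hα n
  have hx0 := gauss_pos hα (n + 1)
  have hx1 := gauss_lt (α := α) (n + 1)
  have hq0 : (0 : ℝ) < cfq α n := by exact_mod_cast (cfq_pos hα n).1
  have hq1 : (0 : ℝ) < cfq α (n + 1) := by exact_mod_cast (cfq_pos hα n).2
  have hqq : (cfq α n : ℝ) ≤ cfq α (n + 1) := by exact_mod_cast cfq_le hα n
  have hq0z : (0 : ℤ) < cfq α n := by exact_mod_cast (cfq_pos hα n).1
  have hq1z : (0 : ℤ) < cfq α (n + 1) := by exact_mod_cast (cfq_pos hα n).2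
  have hlz : (0 : ℤ) < l := by exact_mod_cast hl
  have hl2z : (l : ℤ) < cfq α (n + 1) := by exact_mod_cast hl2
  set x := gaussIter α (n + 1)
  set q := cfq α n
  set q' := cfq α (n + 1)
  set P := cfp α n
  set P' := cfp α (n + 1)
  have hee : ((-1 : ℤ) ^ n) * (-1) ^ n = 1 := by
    rw [← mul_pow]; simp
  set e : ℤ := (-1) ^ n
  set d : ℝ := q * α - P with hd
  obtain ⟨a, ha⟩ : ∃ a : ℤ, a = e * (l * P' - p * q') := ⟨_, rfl⟩
  obtain ⟨b, hb⟩ : ∃ b : ℤ, b = e * (p * q - l * P) := ⟨_, rfl⟩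
  have h1 : a * q + b * q' = (l : ℤ) := by
    rw [ha, hb]
    linear_combination e * l * hdet + l * hee
  have h2 : a * P + b * P' = p := by
    rw [ha, hb]
    linear_combination e * p * hdet + p * hee
  have hdetR : (q : ℝ) * P' - q' * P = (e : ℝ) := by exact_mod_cast hdet
  have h1R : (a : ℝ) * q + b * q' = l := by exact_mod_cast h1
  have h2R : (a : ℝ) * P + b * P' = p := by exact_mod_cast h2
  have hval : (l : ℝ) * α - p = d * (a - b * x) := by
    rw [← h1R, ← h2R]
    linear_combination b * hrec
  have hdd : d * (q' + q * x) = e := by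
    rw [← hdetR]
    linear_combination (q : ℝ) * hrec + (q' : ℝ) * hd
  have heabs : |(e : ℝ)| = 1 := by
    have : (e : ℝ) * e = 1 := by exact_mod_cast hee
    have := abs_mul_abs_self (e : ℝ)
    nlinarith [abs_nonneg (e : ℝ)]
  have hdabs : 1 / (2 * (q' : ℝ)) ≤ |d| := by
    rw [← heabs, ← hdd, abs_mul, abs_of_pos (by positivity : (0:ℝ) < q' + q * x),
      div_le_iff₀ (by positivity)]
    have : (q' : ℝ) + q * x ≤ 2 * q' := by nlinarith
    exact mul_le_mul_of_nonneg_left this (abs_nonneg _)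
  have hab : 1 ≤ |(a : ℝ) - b * x| := by
    rcases lt_trichotomy b 0 with hb0 | hb0 | hb0
    · have : 0 < a := by
        by_contra hc
        push Not at hc
        nlinarith
      have h3 : (1 : ℝ) ≤ a := by exact_mod_cast this
      have h4 : (b : ℝ) ≤ 0 := by exact_mod_cast hb0.le
      refine le_trans ?_ (le_abs_self _)
      nlinarith
    · have h5 : a ≠ 0 := by
        intro h6
        rw [hb0, h6] at h1
        simp at h1
        omega
      rw [hb0]
      simp only [Int.cast_zero, zero_mul, sub_zero]
      exact_mod_cast Int.one_le_abs h5
    · have : a < 0 := by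
        by_contra hc
        push Not at hc
        nlinarith
      have h3 : (a : ℝ) ≤ -1 := by exact_mod_cast (by omega : a ≤ -1)
      have h4 : (0 : ℝ) ≤ b := by exact_mod_cast hb0.le
      rw [abs_sub_comm]
      refine le_trans ?_ (le_abs_self _)
      nlinarith
  rw [hval, abs_mul]
  nlinarith [abs_nonneg d]

end NT

section NT2

/-- The scales used in the construction. -/
structure Dat (α : ℝ) where
  N : ℕ → ℕ
  h : ℕ → ℝ
  N0 : 1000 ≤ N 0
  growth : ∀ j, 1000 * N j ≤ N (j + 1)
  sep : ∀ j (l : ℕ), 0 < l → l < N j → ∀ p : ℤ, 1 / (2 * (N j : ℝ)) ≤ |l * α - p|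
  h_nonneg : ∀ j, 0 ≤ h j
  h_le : ∀ j, h j ≤ N j
  h_sum : ∀ j, ∑ i ∈ Finset.range j, h i / N i ≤ 1
  hbr : ∀ r : ℕ, Summable fun j => (N j : ℝ) ^ r * Real.exp (-∑ i ∈ Finset.range j, h i)

variable {α : ℝ}

lemma step_ex (hα : Irrational α) {δ β : ℝ} (hδ : 0 < δ)
    (h : ∀ᶠ n in atTop, Real.log (cfq α (n + 1) : ℝ) ≤ β * (cfq α n : ℝ) ^ δ) :
    ∃ T : ℕ, ∀ t : ℕ, T ≤ t → ∃ N : ℕ, t ≤ N ∧ Real.log N ≤ |β| * (t : ℝ) ^ δ ∧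
      ∀ l : ℕ, 0 < l → l < N → ∀ p : ℤ, 1 / (2 * (N : ℝ)) ≤ |l * α - p| := by
  classical
  obtain ⟨n1, hn1⟩ := eventually_atTop.1 h
  have hmono : Monotone (cfq α) := monotone_nat_of_le_succ (cfq_le hα)
  refine ⟨cfq α n1 + 1, fun t ht => ?_⟩
  have hex : ∃ m, t ≤ cfq α m := ⟨t, cfq_ge hα t⟩
  obtain ⟨m, hm, hmin⟩ : ∃ m, t ≤ cfq α m ∧ ∀ k < m, ¬ t ≤ cfq α k :=
    ⟨Nat.find hex, Nat.find_spec hex, fun k hk => Nat.find_min hex hk⟩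
  have hmn : n1 < m := by
    by_contra hc
    have := hmono (not_lt.1 hc)
    omega
  obtain ⟨k, rfl⟩ : ∃ k, m = k + 1 := ⟨m - 1, by omega⟩
  refine ⟨cfq α (k + 1), hm, ?_, fun l hl hl2 p => cf_sep hα k l hl hl2 p⟩
  refine (hn1 k (by omega)).trans ?_
  have h1 : cfq α k < t := not_le.1 (hmin k (by omega))
  have h2 : (cfq α k : ℝ) ^ δ ≤ (t : ℝ) ^ δ :=
    Real.rpow_le_rpow (by positivity) (by exact_mod_cast h1.le) hδ.le
  have h3 : (0 : ℝ) ≤ (cfq α k : ℝ) ^ δ := by positivity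
  calc β * (cfq α k : ℝ) ^ δ ≤ |β| * (cfq α k : ℝ) ^ δ :=
        mul_le_mul_of_nonneg_right (le_abs_self _) h3
    _ ≤ _ := mul_le_mul_of_nonneg_left h2 (abs_nonneg _)

lemma rpow_dom {δ γ c : ℝ} (hδ : δ < γ) (hγ : 0 < γ) :
    ∀ᶠ t : ℝ in atTop, c * t ^ δ + Real.log t ≤ t ^ γ := by
  have h0 : (fun t : ℝ => t ^ δ) =o[atTop] fun t : ℝ => t ^ γ := by
    refine (Asymptotics.isLittleO_iff_tendsto' ?_).2 ?_
    · filter_upwards [eventually_gt_atTop 0] with t ht h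
      exact absurd h (Real.rpow_pos_of_pos ht _).ne'
    · refine (tendsto_rpow_neg_atTop (sub_pos.2 hδ)).congr' ?_
      filter_upwards [eventually_gt_atTop 0] with t ht
      rw [neg_sub, Real.rpow_sub ht]
  have h1 : (fun t : ℝ => c * t ^ δ + Real.log t) =o[atTop] fun t : ℝ => t ^ γ :=
    (h0.const_mul_left c).add (isLittleO_log_rpow_atTop hγ)
  filter_upwards [h1.bound one_pos, eventually_gt_atTop 0] with t ht ht0
  rw [one_mul, Real.norm_eq_abs, Real.norm_eq_abs, abs_of_pos (Real.rpow_pos_of_pos ht0 _)] at ht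
  exact (le_abs_self _).trans ht

lemma dat_exists (hα : Irrational α)
    (hBrjuno : ∃ δ : ℝ, 0 < δ ∧ δ < 1 ∧ ∃ β : ℝ, ∀ᶠ n in atTop,
      Real.log (cfq α (n + 1) : ℝ) ≤ β * (cfq α n : ℝ) ^ δ) : Nonempty (Dat α) := by
  obtain ⟨δ, hδ0, hδ1, β, hβ⟩ := hBrjuno
  obtain ⟨T, hT⟩ := step_ex hα hδ0 hβ
  set γ : ℝ := (1 + δ) / 2 with hγ
  have hγ0 : 0 < γ := by linarith
  have hγ1 : 0 < 1 - γ := by linarith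
  have hδγ : δ < γ := by linarith
  obtain ⟨G, hG⟩ : ∃ G : ℕ, 1000 ≤ G ∧ ((G : ℝ)) ^ (-(1 - γ)) ≤ 1 / 2 := by
    have h1 := (tendsto_rpow_neg_atTop hγ1).comp tendsto_natCast_atTop_atTop
    have h2 := h1.eventually (ge_mem_nhds (by norm_num : (0 : ℝ) < 1 / 2))
    obtain ⟨G, h3, h4⟩ := (h2.and (eventually_ge_atTop 1000)).exists
    exact ⟨G, h4, h3⟩
  choose! nx hnx1 hnx2 hnx3 using hT
  obtain ⟨N, hN0, hNs⟩ : ∃ N : ℕ → ℕ, N 0 = nx (T + G) ∧ ∀ j, N (j + 1) = nx (G * N j) :=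
    ⟨fun j => Nat.rec (motive := fun _ => ℕ) (nx (T + G)) (fun _ n => nx (G * n)) j,
      rfl, fun j => rfl⟩
  have hNT : ∀ j, T + G ≤ N j := by
    intro j
    induction j with
    | zero => rw [hN0]; exact hnx1 _ (by omega)
    | succ j ih =>
      rw [hNs]
      have : N j ≤ G * N j := Nat.le_mul_of_pos_left _ (by omega)
      exact (ih.trans this).trans (hnx1 _ (by omega))
  have hNT2 : ∀ j, T ≤ G * N j := fun j => by
    have : N j ≤ G * N j := Nat.le_mul_of_pos_left _ (by omega)
    have := hNT j
    omega
  have hNG : ∀ j, G * N j ≤ N (j + 1) := fun j => by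
    rw [hNs]; exact hnx1 _ (hNT2 j)
  have hNpow : ∀ j, G ^ (j + 1) ≤ N j := by
    intro j
    induction j with
    | zero => have := hNT 0; simp; omega
    | succ j ih =>
      refine le_trans ?_ (hNG j)
      rw [pow_succ' G (j + 1)]
      exact Nat.mul_le_mul_left _ ih
  have hNpos : ∀ j : ℕ, (0 : ℝ) < (N j : ℝ) := fun j => by
    have := hNT j
    exact_mod_cast (by omega : 0 < N j)
  have hN1 : ∀ j : ℕ, (1 : ℝ) ≤ (N j : ℝ) := fun j => by
    have := hNT j
    exact_mod_cast (by omega : 1 ≤ N j)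
  have hGpos : (0 : ℝ) < G := by exact_mod_cast (by omega : 0 < G)
  have hdiv : ∀ j, (N j : ℝ) ^ γ / N j ≤ (1 / 2) ^ (j + 1) := by
    intro j
    have e : (N j : ℝ) ^ γ / N j = (N j : ℝ) ^ (-(1 - γ)) := by
      rw [neg_sub, Real.rpow_sub_one (hNpos j).ne']
    rw [e]
    calc (N j : ℝ) ^ (-(1 - γ)) ≤ ((G : ℝ) ^ (j + 1)) ^ (-(1 - γ)) := by
          refine Real.rpow_le_rpow_of_nonpos (by positivity) (by exact_mod_cast hNpow j) (by linarith)
      _ = ((G : ℝ) ^ (-(1 - γ))) ^ (j + 1) := by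
          rw [← Real.rpow_natCast, ← Real.rpow_mul hGpos.le, mul_comm, Real.rpow_mul hGpos.le,
            Real.rpow_natCast]
      _ ≤ _ := pow_le_pow_left₀ (by positivity) hG.2 _
  refine ⟨⟨N, fun j => (N j : ℝ) ^ γ, ?_, ?_, ?_, ?_, ?_, ?_, ?_⟩⟩
  · have := hNT 0; omega
  · intro j
    exact (Nat.mul_le_mul_right _ hG.1).trans (hNG j)
  · intro j
    cases j with
    | zero => rw [hN0]; exact hnx3 _ (by omega)
    | succ j => rw [hNs]; exact hnx3 _ (hNT2 j)
  · intro j; positivity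
  · intro j
    have := hdiv j
    rw [div_le_iff₀ (hNpos j)] at this
    refine this.trans ?_
    have h3 : ((1 : ℝ) / 2) ^ (j + 1) ≤ 1 := pow_le_one₀ (by norm_num) (by norm_num)
    nlinarith [hNpos j]
  · have h5 : ∀ j, ∑ i ∈ Finset.range j, (N i : ℝ) ^ γ / N i ≤ 1 - (1 / 2) ^ j := by
      intro j
      induction j with
      | zero => simp
      | succ j ih =>
        rw [Finset.sum_range_succ]
        have := hdiv j
        rw [pow_succ] at *
        linarith
    intro j
    refine (h5 j).trans ?_
    have : (0 : ℝ) ≤ (1 / 2) ^ j := by positivity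
    linarith
  · intro r
    rw [← summable_nat_add_iff 1]
    have hdom := rpow_dom (c := r * (|β| * (G : ℝ) ^ δ)) hδγ hγ0
    have hNtend : Tendsto (fun j => (N j : ℝ)) atTop atTop := by
      refine tendsto_natCast_atTop_atTop.comp (tendsto_atTop_mono (fun j => ?_) tendsto_id)
      have h1 := hNpow j
      have h2 : j + 1 < G ^ (j + 1) := Nat.lt_pow_self (by omega)
      simp only [id]
      omega
    refine Summable.of_norm_bounded_eventually_nat (g := fun j => (1 / 2 : ℝ) ^ j)
      (summable_geometric_of_lt_one (by norm_num) (by norm_num)) ?_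
    filter_upwards [hNtend.eventually hdom] with j hj
    have hlog := hnx2 _ (hNT2 j)
    rw [← hNs] at hlog
    rw [Real.norm_of_nonneg (by positivity)]
    have e1 : (N (j + 1) : ℝ) ^ r = Real.exp (r * Real.log (N (j + 1))) := by
      rw [mul_comm, Real.exp_mul, Real.exp_log (hNpos _), Real.rpow_natCast]
    have h6 : (N j : ℝ) ^ γ ≤ ∑ i ∈ Finset.range (j + 1), (N i : ℝ) ^ γ :=
      Finset.single_le_sum (f := fun i => (N i : ℝ) ^ γ) (fun i _ => by positivity)
        (Finset.self_mem_range_succ j)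
    have h7 : r * Real.log (N (j + 1)) ≤ r * (|β| * (G : ℝ) ^ δ) * (N j : ℝ) ^ δ := by
      rw [mul_assoc]
      refine mul_le_mul_of_nonneg_left ?_ (by positivity)
      refine hlog.trans_eq ?_
      push_cast
      rw [Real.mul_rpow hGpos.le (hNpos j).le]
      ring
    rw [e1, ← Real.exp_add]
    calc Real.exp (r * Real.log (N (j + 1)) + -∑ i ∈ Finset.range (j + 1), (N i : ℝ) ^ γ)
        ≤ Real.exp (- Real.log (N j)) := Real.exp_le_exp.2 (by linarith)
      _ = (N j : ℝ)⁻¹ := by rw [Real.exp_neg, Real.exp_log (hNpos j)]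
      _ ≤ ((2 : ℝ) ^ j)⁻¹ := by
          refine inv_anti₀ (by positivity) ?_
          have h8 : 2 ^ j ≤ N j := by
            refine le_trans ?_ (hNpow j)
            refine (Nat.pow_le_pow_right (by norm_num) (by omega : j ≤ j + 1)).trans ?_
            exact Nat.pow_le_pow_left (by omega) _
          exact_mod_cast h8
      _ = (1 / 2) ^ j := by rw [one_div, inv_pow]

end NT2

section Calculus

/-- smooth with derivatives of order between `s` and `r` bounded by `C` -/
def Bdi (s r : ℕ) (C : ℝ) (f : ℝ → ℝ) : Prop :=
  ContDiff ℝ (⊤ : ℕ∞) f ∧ ∀ k, s ≤ k → k ≤ r → ∀ x, ‖iteratedFDeriv ℝ k f x‖ ≤ C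

variable {s r : ℕ} {C C1 C2 : ℝ} {f g : ℝ → ℝ}

lemma natle_top (k : ℕ) : (k : WithTop ℕ∞) ≤ ((⊤ : ℕ∞) : WithTop ℕ∞) := by
  exact_mod_cast (le_top : (k : ℕ∞) ≤ ⊤)

lemma Bdi.mono (h : Bdi s r C1 f) (hC : C1 ≤ C2) : Bdi s r C2 f :=
  ⟨h.1, fun k h1 h2 x => (h.2 k h1 h2 x).trans hC⟩

lemma Bdi.nonneg (h : Bdi 0 r C f) : 0 ≤ C :=
  (norm_nonneg _).trans (h.2 0 le_rfl (Nat.zero_le _) 0)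

lemma Bdi.abs_le (h : Bdi 0 r C f) (x : ℝ) : |f x| ≤ C := by
  have := h.2 0 le_rfl (Nat.zero_le _) x
  rwa [norm_iteratedFDeriv_zero] at this

lemma bdi_const {c : ℝ} (hc : |c| ≤ C) : Bdi s r C (fun _ => c) := by
  refine ⟨contDiff_const, fun k _ _ x => ?_⟩
  cases k with
  | zero => rw [norm_iteratedFDeriv_zero]; exact hc
  | succ k =>
    rw [iteratedFDeriv_succ_const]
    simpa using (abs_nonneg c).trans hc

lemma bdi1_const {c : ℝ} (hs : 1 ≤ s) : Bdi s r 0 (fun _ => c) := by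
  refine ⟨contDiff_const, fun k hk _ x => ?_⟩
  cases k with
  | zero => omega
  | succ k =>
    rw [iteratedFDeriv_succ_const]
    simp

lemma Bdi.add (hf : Bdi s r C1 f) (hg : Bdi s r C2 g) : Bdi s r (C1 + C2) (fun x => f x + g x) := by
  refine ⟨hf.1.add hg.1, fun k h1 h2 x => ?_⟩
  have e : iteratedFDeriv ℝ k (fun x => f x + g x) x
      = iteratedFDeriv ℝ k f x + iteratedFDeriv ℝ k g x :=
    iteratedFDeriv_add_apply ((hf.1.of_le (natle_top k)).contDiffAt) ((hg.1.of_le (natle_top k)).contDiffAt)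
  rw [e]
  exact (norm_add_le _ _).trans (add_le_add (hf.2 k h1 h2 x) (hg.2 k h1 h2 x))

lemma Bdi.smul (hf : Bdi s r C f) (c : ℝ) : Bdi s r (|c| * C) (fun x => c * f x) := by
  refine ⟨contDiff_const.mul hf.1, fun k h1 h2 x => ?_⟩
  have e : iteratedFDeriv ℝ k (fun x => c * f x) x = c • iteratedFDeriv ℝ k f x :=
    iteratedFDeriv_const_smul_apply (a := c) ((hf.1.of_le (natle_top k)).contDiffAt)
  rw [e, norm_smul, Real.norm_eq_abs]
  exact mul_le_mul_of_nonneg_left (hf.2 k h1 h2 x) (abs_nonneg _)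

lemma Bdi.neg (hf : Bdi s r C f) : Bdi s r C (fun x => - f x) := by
  have := hf.smul (-1)
  simpa using this

lemma Bdi.sub (hf : Bdi s r C1 f) (hg : Bdi s r C2 g) : Bdi s r (C1 + C2) (fun x => f x - g x) := by
  have := hf.add hg.neg
  simpa [sub_eq_add_neg] using this

lemma Bdi.shift (hf : Bdi s r C f) (t : ℝ) : Bdi s r C (fun x => f (x + t)) := by
  refine ⟨hf.1.comp (contDiff_id.add contDiff_const), fun k h1 h2 x => ?_⟩
  rw [norm_iteratedFDeriv_eq_norm_iteratedDeriv, iteratedDeriv_comp_add_const,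
    ← norm_iteratedFDeriv_eq_norm_iteratedDeriv]
  exact hf.2 k h1 h2 _

lemma Bdi.shift_sub (hf : Bdi s r C f) (t : ℝ) : Bdi s r C (fun x => f (x - t)) := by
  simpa [sub_eq_add_neg] using hf.shift (-t)

lemma bdi_sum {F : ℕ → ℝ → ℝ} {c : ℕ → ℝ} (n : ℕ) (h : ∀ i < n, Bdi s r (c i) (F i)) :
    Bdi s r (∑ i ∈ Finset.range n, c i) (fun x => ∑ i ∈ Finset.range n, F i x) := by
  induction n with
  | zero => simpa using bdi_const (s := s) (r := r) (C := 0) (c := 0) (by simp)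
  | succ n ih =>
    simp only [Finset.sum_range_succ]
    exact (ih fun i hi => h i (by omega)).add (h n (by omega))

lemma Bdi.mul (hf : Bdi 0 r C1 f) (hg : Bdi 0 r C2 g) :
    Bdi 0 r (2 ^ r * C1 * C2) (fun x => f x * g x) := by
  refine ⟨hf.1.mul hg.1, fun k _ h2 x => ?_⟩
  refine (norm_iteratedFDeriv_mul_le hf.1 hg.1 x (natle_top k)).trans ?_
  have h0 := hf.nonneg
  have h0' := hg.nonneg
  calc _ ≤ ∑ i ∈ Finset.range (k + 1), (k.choose i : ℝ) * (C1 * C2) := by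
        refine Finset.sum_le_sum fun i hi => ?_
        rw [mul_assoc]
        have := Finset.mem_range.1 hi
        refine mul_le_mul_of_nonneg_left ?_ (by positivity)
        exact mul_le_mul (hf.2 i (Nat.zero_le _) (by omega) x) (hg.2 _ (Nat.zero_le _) (by omega) x)
          (norm_nonneg _) h0
    _ = 2 ^ k * (C1 * C2) := by
        rw [← Finset.sum_mul]
        congr 1
        exact_mod_cast Nat.sum_range_choose k
    _ ≤ 2 ^ r * (C1 * C2) :=
        mul_le_mul_of_nonneg_right (pow_le_pow_right₀ (by norm_num) h2) (by positivity)
    _ = _ := by ring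

/-- composition bound -/
lemma Bdi.comp_le {D : ℝ} (hD : 1 ≤ D) (hf : Bdi 1 r D f) (hg : ContDiff ℝ (⊤ : ℕ∞) g)
    (hC : ∀ k ≤ r, ∀ x, ‖iteratedFDeriv ℝ k g (f x)‖ ≤ C) :
    Bdi 0 r (r.factorial * C * D ^ r) (fun x => g (f x)) := by
  have hC0 : 0 ≤ C := (norm_nonneg _).trans (hC 0 (Nat.zero_le _) 0)
  refine ⟨hg.comp hf.1, fun k _ h2 x => ?_⟩
  have := norm_iteratedFDeriv_comp_le hg hf.1 (natle_top k) x
    (fun i hi => hC i (by omega) x)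
    (fun i hi hi2 => (hf.2 i hi (by omega) x).trans (le_self_pow₀ hD (by omega)))
  refine this.trans ?_
  have h3 : (k.factorial : ℝ) ≤ r.factorial := by exact_mod_cast Nat.factorial_le h2
  have h4 : D ^ k ≤ D ^ r := pow_le_pow_right₀ hD h2
  gcongr

lemma Bdi.exp {D B : ℝ} (hD : 1 ≤ D) (hf : Bdi 1 r D f) (hB : ∀ x, f x ≤ B) :
    Bdi 0 r (r.factorial * Real.exp B * D ^ r) (fun x => Real.exp (f x)) := by
  refine hf.comp_le hD Real.contDiff_exp fun k _ x => ?_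
  rw [norm_iteratedFDeriv_eq_norm_iteratedDeriv, iteratedDeriv_eq_iterate, Real.iter_deriv_exp,
    Real.norm_eq_abs, abs_of_pos (Real.exp_pos _)]
  exact Real.exp_le_exp.2 (hB x)

/-- limits of functions in all `C^r` -/
lemma bdi_limit {f : ℕ → ℝ → ℝ} {v : ℕ → ℕ → ℝ}
    (hv : ∀ r, Summable (v r)) (h : ∀ r j, Bdi 0 r (v r j) (fun x => f (j + 1) x - f j x)) :
    ∃ g : ℝ → ℝ, ∀ r, ∃ w : ℕ → ℝ, Tendsto w atTop (nhds 0) ∧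
      ∀ j, Bdi 0 r (w j) (fun x => f j x - g x) := by
  have hs : ∀ x, Summable fun j => f (j + 1) x - f j x := fun x =>
    Summable.of_norm_bounded (hv 0) fun j => (h 0 j).abs_le x
  have htel : ∀ j x, f j x = f 0 x + ∑ i ∈ Finset.range j, (f (i + 1) x - f i x) := by
    intro j x
    rw [Finset.sum_range_sub (fun i => f i x)]; ring
  refine ⟨fun x => f 0 x + ∑' i, (f (i + 1) x - f i x), fun r => ?_⟩
  refine ⟨fun j => ∑' i, v r (i + j), tendsto_sum_nat_add (v r), fun j => ?_⟩
  have e : (fun x => f j x - (f 0 x + ∑' i, (f (i + 1) x - f i x))) =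
      fun x => - ∑' i, (f (i + j + 1) x - f (i + j) x) := by
    funext x
    rw [htel j x, ← (hs x).sum_add_tsum_nat_add j]
    ring
  rw [e]
  refine Bdi.neg ?_
  have hb : ∀ (k i : ℕ) (x : ℝ), ((k : ℕ) : ℕ∞) ≤ (⊤ : ℕ∞) →
      ‖iteratedFDeriv ℝ k (fun x => f (i + j + 1) x - f (i + j) x) x‖ ≤ v k (i + j) :=
    fun k i x _ => (h k (i + j)).2 k (Nat.zero_le _) le_rfl x
  have hvs : ∀ k : ℕ, ((k : ℕ) : ℕ∞) ≤ (⊤ : ℕ∞) → Summable fun i => v k (i + j) :=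
    fun k _ => (summable_nat_add_iff j).2 (hv k)
  refine ⟨contDiff_tsum (fun i => (h 0 (i + j)).1) hvs hb, fun k _ hk x => ?_⟩
  rw [iteratedFDeriv_tsum_apply (fun i => (h 0 (i + j)).1) hvs hb le_top x]
  refine tsum_of_norm_bounded ((summable_nat_add_iff j).2 (hv r)).hasSum fun i => ?_
  exact (h r (i + j)).2 k (Nat.zero_le _) hk x

end Calculus

section MatCalc

/-- matrix version -/
def BdM (r : ℕ) (C : ℝ) (M : ℝ → Matrix (Fin 2) (Fin 2) ℝ) : Prop :=
  ∀ a b, Bdi 0 r C (fun x => M x a b)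

variable {r : ℕ} {C C1 C2 : ℝ} {M M' : ℝ → Matrix (Fin 2) (Fin 2) ℝ}

lemma BdM.mono (h : BdM r C1 M) (hC : C1 ≤ C2) : BdM r C2 M := fun a b => (h a b).mono hC

lemma BdM.nonneg (h : BdM r C M) : 0 ≤ C := (h 0 0).nonneg

lemma BdM.add (h : BdM r C1 M) (h' : BdM r C2 M') : BdM r (C1 + C2) (fun x => M x + M' x) :=
  fun a b => (h a b).add (h' a b)

lemma BdM.sub (h : BdM r C1 M) (h' : BdM r C2 M') : BdM r (C1 + C2) (fun x => M x - M' x) :=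
  fun a b => (h a b).sub (h' a b)

lemma BdM.shift (h : BdM r C M) (t : ℝ) : BdM r C (fun x => M (x + t)) :=
  fun a b => (h a b).shift t

lemma BdM.mul (h : BdM r C1 M) (h' : BdM r C2 M') :
    BdM r (2 ^ (r + 1) * C1 * C2) (fun x => M x * M' x) := by
  intro a b
  have := ((h a 0).mul (h' 0 b)).add ((h a 1).mul (h' 1 b))
  simp only [Matrix.mul_apply, Fin.sum_univ_two]
  exact this.mono (le_of_eq (by ring))

lemma BdM.adj (h : BdM r C M) : BdM r C (fun x => (M x).adjugate) := by
  intro a b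
  simp only [Matrix.adjugate_fin_two]
  fin_cases a <;> fin_cases b
  · simpa using h 1 1
  · simpa using (h 0 1).neg
  · simpa using (h 1 0).neg
  · simpa using h 0 0

lemma bdM_of {a b c d : ℝ → ℝ} (ha : Bdi 0 r C a) (hb : Bdi 0 r C b) (hc : Bdi 0 r C c)
    (hd : Bdi 0 r C d) : BdM r C (fun x => !![a x, b x; c x, d x]) := by
  intro i j
  fin_cases i <;> fin_cases j
  · simpa using ha
  · simpa using hb
  · simpa using hc
  · simpa using hd

lemma BdM.smooth (h : BdM r C M) : ContDiff ℝ (⊤ : ℕ∞) M := by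
  refine contDiff_pi.2 fun a => contDiff_pi.2 fun b => (h a b).1

lemma bdM_const (A : Matrix (Fin 2) (Fin 2) ℝ) (h : ∀ a b, |A a b| ≤ C) :
    BdM r C (fun _ => A) := fun a b => bdi_const (h a b)

lemma BdM.opNorm_le (h : BdM r C M) (x : ℝ) : opNorm (M x) ≤ 4 * C := by
  refine (_root_.opNorm_le _).trans ?_
  linarith [(h 0 0).abs_le x, (h 0 1).abs_le x, (h 1 0).abs_le x, (h 1 1).abs_le x]

def entryCLM (a b : Fin 2) : Matrix (Fin 2) (Fin 2) ℝ →L[ℝ] ℝ :=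
  (ContinuousLinearMap.proj (R := ℝ) (φ := fun _ : Fin 2 => ℝ) b).comp
    (ContinuousLinearMap.proj (R := ℝ) (φ := fun _ : Fin 2 => Fin 2 → ℝ) a)

lemma iter_entry (hM : ContDiff ℝ (⊤ : ℕ∞) M) (k : ℕ) (x : ℝ) (a b : Fin 2) :
    (iteratedDeriv k M x) a b = iteratedDeriv k (fun x => M x a b) x := by
  have h1 := (entryCLM a b).iteratedFDeriv_comp_left (f := M) (x := x)
    ((hM.of_le (natle_top k)).contDiffAt) (i := k) le_rfl
  have h3 : iteratedDeriv k (entryCLM a b ∘ M) x = entryCLM a b (iteratedDeriv k M x) := by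
    rw [iteratedDeriv_eq_iteratedFDeriv, iteratedDeriv_eq_iteratedFDeriv]
    exact congrArg (fun m => m (fun _ => (1 : ℝ))) h1
  exact h3.symm

lemma BdM.cNorm_le (h : BdM r C M) : cNorm r M ≤ C := by
  have h0 := h.nonneg
  unfold cNorm
  refine ciSup_le fun k => ciSup_le fun x => ?_
  refine (Matrix.norm_le_iff h0).2 fun a b => ?_
  rw [iter_entry h.smooth, ← norm_iteratedFDeriv_eq_norm_iteratedDeriv]
  exact (h a b).2 k (Nat.zero_le _) (by omega) x

lemma cNorm_nonneg : 0 ≤ cNorm r M :=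
  Real.iSup_nonneg fun _ => Real.iSup_nonneg fun _ => norm_nonneg _

end MatCalc

section Bump

def bump : ContDiffBump (0 : ℝ) := ⟨1 / 2, 1, by norm_num, by norm_num⟩

/-- periodic bump at scale `1/N` -/
def chi (N : ℕ) (y : ℝ) : ℝ := bump (2 * N * Real.sin (Real.pi * y))

lemma chi_nonneg (N : ℕ) (y : ℝ) : 0 ≤ chi N y := bump.nonneg

lemma chi_le_one (N : ℕ) (y : ℝ) : chi N y ≤ 1 := bump.le_one

lemma chi_per (N : ℕ) : Function.Periodic (chi N) 1 := by
  intro y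
  unfold chi
  rw [show Real.pi * (y + 1) = Real.pi * y + Real.pi by ring, Real.sin_add_pi, mul_neg]
  exact bump.neg _

lemma chi_ne {N : ℕ} (hN : 0 < N) {y : ℝ} (h : chi N y ≠ 0) :
    |Real.sin (Real.pi * y)| < 1 / (2 * N) := by
  have hN' : (0 : ℝ) < N := by exact_mod_cast hN
  have h1 : 2 * N * Real.sin (Real.pi * y) ∈ Function.support bump := h
  rw [bump.support_eq, mem_ball_zero_iff, Real.norm_eq_abs, abs_mul,
    abs_of_pos (by positivity : (0 : ℝ) < 2 * N)] at h1
  have h2 : bump.rOut = 1 := rfl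
  rw [h2] at h1
  rw [lt_div_iff₀ (by positivity)]
  linarith

lemma chi_one {N : ℕ} (hN : 0 < N) {y : ℝ} (h : |Real.sin (Real.pi * y)| ≤ 1 / (4 * N)) :
    chi N y = 1 := by
  have hN' : (0 : ℝ) < N := by exact_mod_cast hN
  unfold chi
  refine bump.one_of_mem_closedBall ?_
  rw [mem_closedBall_zero_iff, Real.norm_eq_abs, abs_mul,
    abs_of_pos (by positivity : (0 : ℝ) < 2 * N)]
  have h2 : bump.rIn = 1 / 2 := rfl
  rw [h2]
  rw [le_div_iff₀ (by positivity)] at h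
  linarith

lemma sin_bdi (r : ℕ) : Bdi 0 r (4 ^ r) (fun y => Real.sin (Real.pi * y)) := by
  refine ⟨Real.contDiff_sin.comp (contDiff_const.mul contDiff_id), fun k _ hk x => ?_⟩
  rw [norm_iteratedFDeriv_eq_norm_iteratedDeriv, iteratedDeriv_comp_const_mul
    (Real.contDiff_sin), norm_mul, norm_pow, Real.norm_eq_abs, Real.norm_eq_abs,
    abs_of_pos Real.pi_pos]
  have h1 := Real.abs_iteratedDeriv_sin_le_one k (Real.pi * x)
  have h2 : Real.pi ^ k ≤ 4 ^ k := pow_le_pow_left₀ Real.pi_pos.le Real.pi_le_four k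
  have h3 : (4 : ℝ) ^ k ≤ 4 ^ r := pow_le_pow_right₀ (by norm_num) hk
  have h4 : 0 ≤ Real.pi ^ k := by positivity
  nlinarith [abs_nonneg (iteratedDeriv k Real.sin (Real.pi * x))]

lemma bump_bdd (r : ℕ) : ∃ C : ℝ, 1 ≤ C ∧ ∀ k ≤ r, ∀ x, ‖iteratedFDeriv ℝ k bump x‖ ≤ C := by
  have h : ∀ k : ℕ, ∃ C : ℝ, ∀ x, ‖iteratedFDeriv ℝ k bump x‖ ≤ C := by
    intro k
    have hc : ContDiff ℝ k bump := bump.contDiff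
    exact (bump.hasCompactSupport.iteratedFDeriv k).exists_bound_of_continuous
      (hc.continuous_iteratedFDeriv le_rfl)
  choose C hC using h
  refine ⟨1 + ∑ k ∈ Finset.range (r + 1), |C k|, ?_, fun k hk x => ?_⟩
  · have : 0 ≤ ∑ k ∈ Finset.range (r + 1), |C k| := Finset.sum_nonneg fun _ _ => abs_nonneg _
    linarith
  · have := Finset.single_le_sum (f := fun k => |C k|) (fun i _ => abs_nonneg _)
      (Finset.mem_range.2 (by omega : k < r + 1))
    have := (hC k x).trans (le_abs_self _)
    linarith

lemma chi_bdi (r : ℕ) : ∃ b : ℝ, 1 ≤ b ∧ ∀ N : ℕ, 0 < N → Bdi 0 r (b * (N : ℝ) ^ r) (chi N) := by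
  obtain ⟨C, hC1, hC⟩ := bump_bdd r
  have hf : (1 : ℝ) ≤ r.factorial := by exact_mod_cast Nat.one_le_iff_ne_zero.2 (Nat.factorial_ne_zero r)
  have h4 : (1 : ℝ) ≤ 4 ^ r := one_le_pow₀ (by norm_num)
  refine ⟨r.factorial * C * (2 * 4 ^ r) ^ r, ?_, fun N hN => ?_⟩
  · have h5 : (1 : ℝ) ≤ (2 * 4 ^ r) ^ r := one_le_pow₀ (by linarith)
    nlinarith [mul_le_mul hf hC1 (by norm_num) (by linarith)]
  · have hN' : (1 : ℝ) ≤ N := by exact_mod_cast hN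
    have h1 := (sin_bdi r).smul (2 * N)
    rw [abs_of_pos (by positivity)] at h1
    have h2 : Bdi 1 r (2 * N * 4 ^ r) (fun y => 2 * N * Real.sin (Real.pi * y)) :=
      ⟨h1.1, fun k _ hk x => h1.2 k (Nat.zero_le _) hk x⟩
    have h3 := h2.comp_le (by nlinarith) (g := bump) bump.contDiff
      (fun k hk x => hC k hk _)
    refine h3.mono (le_of_eq ?_)
    rw [show (2 * N * 4 ^ r : ℝ) = (2 * 4 ^ r) * N by ring, mul_pow]
    ring

lemma sin_lower {t c : ℝ} (hc : ∀ p : ℤ, c ≤ |t - p|) : 2 * c ≤ |Real.sin (Real.pi * t)| := by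
  have h1 : |t - round t| ≤ 1 / 2 := abs_sub_round t
  have h2 : |Real.sin (Real.pi * t)| = |Real.sin (Real.pi * (t - round t))| := by
    rw [mul_sub, mul_comm Real.pi (round t : ℝ), Real.sin_sub_int_mul_pi, abs_mul, abs_zpow]
    simp
  have h3 : |Real.pi * (t - round t)| ≤ Real.pi / 2 := by
    rw [abs_mul, abs_of_pos Real.pi_pos]
    nlinarith [Real.pi_pos]
  have h4 := Real.mul_abs_le_abs_sin h3
  rw [abs_mul, abs_of_pos Real.pi_pos, ← mul_assoc, div_mul_cancel₀ _ Real.pi_pos.ne'] at h4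
  rw [h2]
  linarith [hc (round t)]

end Bump

namespace Dat
section
variable {α : ℝ} (d : Dat α)

lemma N_ge (j : ℕ) : 1000 ≤ d.N j := by
  induction j with
  | zero => exact d.N0
  | succ j ih => have := d.growth j; omega

lemma N_pos (j : ℕ) : 0 < d.N j := by have := d.N_ge j; omega

lemma N_geR (j : ℕ) : (1000 : ℝ) ≤ d.N j := by exact_mod_cast d.N_ge j

lemma growthR (j : ℕ) : (1000 : ℝ) * d.N j ≤ d.N (j + 1) := by exact_mod_cast d.growth j

def H (j : ℕ) : ℝ := ∑ i ∈ Finset.range j, d.h i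

def psi (j : ℕ) (x : ℝ) : ℝ := ∑ i ∈ Finset.range j, d.h i * chi (d.N i) x

lemma H_succ (j : ℕ) : d.H (j + 1) = d.H j + d.h j := Finset.sum_range_succ _ _

lemma psi_succ (j : ℕ) (x : ℝ) : d.psi (j + 1) x = d.psi j x + d.h j * chi (d.N j) x :=
  Finset.sum_range_succ _ _

lemma H_nonneg (j : ℕ) : 0 ≤ d.H j := Finset.sum_nonneg fun i _ => d.h_nonneg i

lemma psi_nonneg (j : ℕ) (x : ℝ) : 0 ≤ d.psi j x :=
  Finset.sum_nonneg fun i _ => mul_nonneg (d.h_nonneg i) (chi_nonneg _ _)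

lemma psi_le (j : ℕ) (x : ℝ) : d.psi j x ≤ d.H j :=
  Finset.sum_le_sum fun i _ => mul_le_of_le_one_right (d.h_nonneg i) (chi_le_one _ _)

lemma psi_per (j : ℕ) : Function.Periodic (d.psi j) 1 := by
  intro x
  unfold psi
  exact Finset.sum_congr rfl fun i _ => by rw [chi_per]

lemma sumN_le (j : ℕ) : ∑ i ∈ Finset.range j, (d.N i : ℝ) ≤ d.N j / 999 := by
  induction j with
  | zero => simp; positivity
  | succ j ih =>
    rw [Finset.sum_range_succ]
    have := d.growthR j
    linarith

lemma H_le (j : ℕ) : d.H j ≤ d.N j / 999 :=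
  (Finset.sum_le_sum fun i _ => d.h_le i).trans (d.sumN_le j)

lemma N_mono {i j : ℕ} (h : i < j) : (2 : ℝ) * d.N i ≤ d.N j := by
  induction j with
  | zero => omega
  | succ j ih =>
    have h1 := d.growthR j
    have h2 := d.N_geR j
    rcases Nat.lt_succ_iff_lt_or_eq.1 h with h3 | rfl
    · linarith [ih h3]
    · linarith

lemma chi_nested {i j : ℕ} (h : i < j) {x : ℝ} (hx : chi (d.N j) x ≠ 0) : chi (d.N i) x = 1 := by
  refine chi_one (d.N_pos i) ?_
  refine (chi_ne (d.N_pos j) hx).le.trans ?_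
  have h1 := d.N_geR i
  have h2 := d.N_mono h
  exact one_div_le_one_div_of_le (by linarith) (by linarith)

lemma psi_eq {j : ℕ} {x : ℝ} (hx : chi (d.N j) x ≠ 0) : d.psi j x = d.H j := by
  unfold psi H
  refine Finset.sum_congr rfl fun i hi => ?_
  rw [d.chi_nested (Finset.mem_range.1 hi) hx, mul_one]

lemma chi_sep {j l : ℕ} (hl : 0 < l) (hl2 : l < d.N j) {x : ℝ} (hx : chi (d.N j) x ≠ 0) :
    chi (d.N j) (x + l * α) = 0 := by
  by_contra hc
  have h1 := chi_ne (d.N_pos j) hx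
  have h2 := chi_ne (d.N_pos j) hc
  have h3 := sin_lower (d.sep j l hl hl2)
  have e : Real.sin (Real.pi * (l * α)) = Real.sin (Real.pi * (x + l * α)) * Real.cos (Real.pi * x)
      - Real.cos (Real.pi * (x + l * α)) * Real.sin (Real.pi * x) := by
    rw [← Real.sin_sub]; congr 1; ring
  have h4 : |Real.sin (Real.pi * (l * α))| ≤
      |Real.sin (Real.pi * (x + l * α))| + |Real.sin (Real.pi * x)| := by
    rw [e]
    refine (abs_sub _ _).trans (add_le_add ?_ ?_)
    · rw [abs_mul]; exact mul_le_of_le_one_right (abs_nonneg _) (Real.abs_cos_le_one _)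
    · rw [abs_mul]; exact mul_le_of_le_one_left (abs_nonneg _) (Real.abs_cos_le_one _)
  linarith

/-- at most one visit -/
lemma chi_uniq {j : ℕ} {x : ℝ} {a b : ℤ} (hab : |a - b| < d.N j)
    (ha : chi (d.N j) (x + a * α) ≠ 0) (hb : chi (d.N j) (x + b * α) ≠ 0) : a = b := by
  have key : ∀ a b : ℤ, a < b → |a - b| < d.N j → chi (d.N j) (x + a * α) ≠ 0 →
      chi (d.N j) (x + b * α) = 0 := by
    intro a b h hab ha
    obtain ⟨l, hl⟩ : ∃ l : ℕ, b = a + l := ⟨(b - a).toNat, by omega⟩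
    have := d.chi_sep (j := j) (l := l) (by omega) (by rw [abs_lt] at hab; omega) ha
    rw [hl]
    push_cast
    rw [show x + (a + l) * α = x + a * α + l * α by ring]
    exact this
  rcases lt_trichotomy a b with h | h | h
  · exact absurd (key a b h hab ha) hb
  · exact h
  · exact absurd (key b a h (by rwa [abs_sub_comm]) hb) ha

lemma chi_sum_le_one (j : ℕ) (x : ℝ) {k : ℕ} (hk : k ≤ d.N j) :
    ∑ l ∈ Finset.range k, chi (d.N j) (x + l * α) ≤ 1 := by
  by_cases h : ∃ l ∈ Finset.range k, chi (d.N j) (x + l * α) ≠ 0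
  · obtain ⟨l, hl, hl2⟩ := h
    rw [Finset.sum_eq_single_of_mem l hl]
    · exact chi_le_one _ _
    · intro m hm hne
      by_contra hc
      have h1 := Finset.mem_range.1 hl
      have h2 := Finset.mem_range.1 hm
      have := d.chi_uniq (j := j) (x := x) (a := (m : ℤ)) (b := (l : ℤ))
        (by rw [abs_lt]; omega) (by exact_mod_cast hc) (by exact_mod_cast hl2)
      omega
  · push Not at h
    rw [Finset.sum_eq_zero h]
    norm_num

lemma chi_sum_le (j : ℕ) (k : ℕ) (x : ℝ) :
    ∑ l ∈ Finset.range k, chi (d.N j) (x + l * α) ≤ k / d.N j + 1 := by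
  have hN := d.N_geR j
  induction k using Nat.strong_induction_on generalizing x with
  | _ k ih =>
    rcases le_or_gt k (d.N j) with hk | hk
    · have := d.chi_sum_le_one j x hk
      have : (0 : ℝ) ≤ k / d.N j := by positivity
      linarith
    · obtain ⟨m, rfl⟩ := Nat.exists_eq_add_of_lt hk
      rw [show d.N j + m + 1 = d.N j + (m + 1) by ring, Finset.sum_range_add]
      have h1 := d.chi_sum_le_one j x le_rfl
      have h2 := ih (m + 1) (by have := d.N_pos j; omega) (x + d.N j * α)
      have h3 : ∑ l ∈ Finset.range (m + 1), chi (d.N j) (x + (d.N j + l : ℕ) * α) =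
          ∑ l ∈ Finset.range (m + 1), chi (d.N j) (x + d.N j * α + l * α) := by
        refine Finset.sum_congr rfl fun l _ => ?_
        congr 1; push_cast; ring
      rw [h3]
      have h4 : ((d.N j + (m + 1) : ℕ) : ℝ) / d.N j = 1 + ((m + 1 : ℕ) : ℝ) / d.N j := by
        push_cast; field_simp
      rw [h4]
      linarith

lemma psi_sum_le (j k : ℕ) (x : ℝ) :
    ∑ l ∈ Finset.range k, d.psi j (x + l * α) ≤ k + d.H j := by
  unfold psi H
  rw [Finset.sum_comm]
  calc _ ≤ ∑ i ∈ Finset.range j, (k * (d.h i / d.N i) + d.h i) := by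
        refine Finset.sum_le_sum fun i _ => ?_
        rw [← Finset.mul_sum]
        have := mul_le_mul_of_nonneg_left (d.chi_sum_le i k x) (d.h_nonneg i)
        refine this.trans (le_of_eq ?_)
        ring
    _ = k * (∑ i ∈ Finset.range j, d.h i / d.N i) + ∑ i ∈ Finset.range j, d.h i := by
        rw [Finset.sum_add_distrib, Finset.mul_sum]
    _ ≤ _ := by
        have := mul_le_mul_of_nonneg_left (d.h_sum j) (by positivity : (0 : ℝ) ≤ k)
        linarith

lemma psi_sum_le' (j k : ℕ) (x : ℝ) :
    ∑ l ∈ Finset.range k, d.psi j (x - (l + 1 : ℕ) * α) ≤ k + d.H j := by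
  refine le_trans (le_of_eq ?_) (d.psi_sum_le j k (x - k * α))
  rw [← Finset.sum_range_reflect]
  refine Finset.sum_congr rfl fun l hl => ?_
  have := Finset.mem_range.1 hl
  congr 1
  rw [show k - 1 - l + 1 = k - l by omega, Nat.cast_sub this.le]
  ring

lemma chi_cont (N : ℕ) : Continuous (chi N) := by
  unfold chi
  exact (bump.continuous).comp (by fun_prop)

lemma psi_cont (j : ℕ) : Continuous (d.psi j) := by
  unfold psi
  exact continuous_finsetSum _ fun i _ => continuous_const.mul (chi_cont _)

lemma int_chi (j : ℕ) : ∫ x in (0 : ℝ)..1, chi (d.N j) x ≤ 1 / d.N j := by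
  have hN := d.N_geR j
  rw [le_div_iff₀ (by linarith)]
  have h1 : ∫ x in (0 : ℝ)..1, ∑ l ∈ Finset.range (d.N j), chi (d.N j) (x + l * α)
      = (∫ x in (0 : ℝ)..1, chi (d.N j) x) * d.N j := by
    rw [intervalIntegral.integral_finsetSum]
    · rw [Finset.sum_congr rfl fun (l : ℕ) _ => int_shift (chi_per (d.N j)) ((l : ℝ) * α)]
      simp [mul_comm]
    · intro l _
      exact (cont_shift (chi_cont _) _).intervalIntegrable _ _
  rw [← h1]
  have := intervalIntegral.integral_mono (a := 0) (b := 1) (μ := volume)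
    (f := fun x => ∑ l ∈ Finset.range (d.N j), chi (d.N j) (x + l * α)) (g := fun _ => (1 : ℝ))
    (by norm_num)
    ((continuous_finsetSum _ fun l _ => cont_shift (chi_cont _) _).intervalIntegrable _ _)
    (by simp) (fun x => d.chi_sum_le_one j x le_rfl)
  simpa using this

lemma int_psi (j : ℕ) : ∫ x in (0 : ℝ)..1, d.psi j x ≤ 1 := by
  unfold psi
  rw [intervalIntegral.integral_finsetSum]
  · refine le_trans (Finset.sum_le_sum fun i _ => ?_) (d.h_sum j)
    rw [intervalIntegral.integral_const_mul]
    have := mul_le_mul_of_nonneg_left (d.int_chi i) (d.h_nonneg i)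
    refine this.trans (le_of_eq ?_)
    ring
  · intro i _
    exact (continuous_const.mul (chi_cont _)).intervalIntegrable _ _

end
end Dat

namespace Dat
section Towers
variable {α : ℝ} (d : Dat α)

def M (j : ℕ) : ℕ := d.N j / 4

def G (j : ℕ) (y : ℝ) : ℝ := Real.exp (d.H j) * (Real.exp (d.h j * chi (d.N j) y) - 1)

def S (j k : ℕ) (y : ℝ) : ℝ :=
  Real.exp (-2000 * ((k + 1 : ℕ) : ℝ) +
    2 * ∑ l ∈ Finset.range k, d.psi j (y + ((l + 1 : ℕ) : ℝ) * α)) * d.G j y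

def T (j k : ℕ) (y : ℝ) : ℝ :=
  Real.exp (-2000 * (k : ℝ) +
    2 * ∑ l ∈ Finset.range k, d.psi j (y - ((l + 1 : ℕ) : ℝ) * α)) * d.G j y

def sig (j : ℕ) (x : ℝ) : ℝ :=
  ∑ k ∈ Finset.range (d.M j), d.S j k (x - ((k + 1 : ℕ) : ℝ) * α)

def tau (j : ℕ) (x : ℝ) : ℝ :=
  ∑ k ∈ Finset.range (d.M j), d.T j k (x + (k : ℝ) * α)

def Sc (j : ℕ) (x : ℝ) : ℝ := d.S j (d.M j) (x - (d.M j : ℝ) * α)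

def Tc (j : ℕ) (x : ℝ) : ℝ := d.T j (d.M j) (x + (d.M j : ℝ) * α)

def a (j : ℕ) (x : ℝ) : ℝ := Real.exp (1000 - d.psi j x)

def ai (j : ℕ) (x : ℝ) : ℝ := Real.exp (-(1000 - d.psi j x))

lemma a_ai (j : ℕ) (x : ℝ) : d.a j x * d.ai j x = 1 := by
  unfold a ai
  rw [← Real.exp_add, add_neg_cancel, Real.exp_zero]

lemma ai_sq (j : ℕ) (x : ℝ) : d.ai j x ^ 2 = Real.exp (-2000 + 2 * d.psi j x) := by
  unfold ai
  rw [← Real.exp_nat_mul]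
  congr 1; push_cast; ring

lemma S_succ (j k : ℕ) (x : ℝ) : d.S j (k + 1) (x - ((k + 1 : ℕ) : ℝ) * α) =
    d.ai j x ^ 2 * d.S j k (x - ((k + 1 : ℕ) : ℝ) * α) := by
  unfold S
  rw [ai_sq, ← mul_assoc, ← Real.exp_add, Finset.sum_range_succ]
  congr 2
  rw [sub_add_cancel]
  push_cast
  ring

lemma T_succ (j k : ℕ) (x : ℝ) : d.T j (k + 1) (x + ((k + 1 : ℕ) : ℝ) * α) =
    d.ai j x ^ 2 * d.T j k (x + α + (k : ℝ) * α) := by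
  unfold T
  have e : x + α + (k : ℝ) * α = x + ((k + 1 : ℕ) : ℝ) * α := by push_cast; ring
  rw [ai_sq, ← mul_assoc, ← Real.exp_add, Finset.sum_range_succ, e]
  congr 2
  rw [add_sub_cancel_right]
  push_cast
  ring

lemma sig_rec (j : ℕ) (x : ℝ) : d.sig j (x + α) =
    Real.exp (-2000) * d.G j x + d.ai j x ^ 2 * d.sig j x - d.Sc j x := by
  have h1 : d.sig j (x + α) + d.Sc j x =
      ∑ k ∈ Finset.range (d.M j + 1), d.S j k (x - (k : ℝ) * α) := by
    rw [Finset.sum_range_succ]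
    unfold sig Sc
    congr 1
    refine Finset.sum_congr rfl fun k _ => ?_
    congr 1; push_cast; ring
  rw [Finset.sum_range_succ', Finset.sum_congr rfl fun k _ => d.S_succ j k x, ← Finset.mul_sum] at h1
  have h2 : d.S j 0 (x - ((0 : ℕ) : ℝ) * α) = Real.exp (-2000) * d.G j x := by
    unfold S; simp
  rw [h2] at h1
  unfold sig at *
  linarith

lemma tau_rec (j : ℕ) (x : ℝ) : d.tau j x =
    d.G j x + d.ai j x ^ 2 * d.tau j (x + α) - d.Tc j x := by
  have h1 : d.tau j x + d.Tc j x =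
      ∑ k ∈ Finset.range (d.M j + 1), d.T j k (x + (k : ℝ) * α) := by
    rw [Finset.sum_range_succ]
    rfl
  rw [Finset.sum_range_succ', Finset.sum_congr rfl fun k _ => d.T_succ j k x, ← Finset.mul_sum] at h1
  have h2 : d.T j 0 (x + ((0 : ℕ) : ℝ) * α) = d.G j x := by
    unfold T; simp
  rw [h2] at h1
  unfold tau at *
  linarith

lemma G_zero {j : ℕ} {y : ℝ} (h : chi (d.N j) y = 0) : d.G j y = 0 := by
  unfold G; rw [h]; simp

lemma sig_ne {j : ℕ} {x : ℝ} (h : d.sig j x ≠ 0) :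
    ∃ b : ℤ, 1 ≤ b ∧ b ≤ d.M j ∧ chi (d.N j) (x + (-b : ℤ) * α) ≠ 0 := by
  obtain ⟨k, hk, hk2⟩ := Finset.exists_ne_zero_of_sum_ne_zero h
  refine ⟨k + 1, by omega, by have := Finset.mem_range.1 hk; omega, fun hc => hk2 ?_⟩
  unfold S
  rw [d.G_zero, mul_zero]
  rw [← hc]; congr 1; push_cast; ring

lemma tau_ne {j : ℕ} {x : ℝ} (h : d.tau j x ≠ 0) :
    ∃ b : ℤ, 0 ≤ b ∧ b < d.M j ∧ chi (d.N j) (x + b * α) ≠ 0 := by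
  obtain ⟨k, hk, hk2⟩ := Finset.exists_ne_zero_of_sum_ne_zero h
  refine ⟨k, by omega, by have := Finset.mem_range.1 hk; omega, fun hc => hk2 ?_⟩
  unfold T
  rw [d.G_zero, mul_zero]
  rw [← hc]; congr 1

lemma M_lt (j : ℕ) : 4 * d.M j ≤ d.N j := by unfold M; omega

lemma M_pos (j : ℕ) : 1 ≤ d.M j := by unfold M; have := d.N_ge j; omega

lemma st_zero (j : ℕ) (x : ℝ) : d.tau j x * d.sig j x = 0 := by
  by_contra hc
  obtain ⟨b, hb1, hb2, hb3⟩ := d.sig_ne (right_ne_zero_of_mul hc)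
  obtain ⟨c, hc1, hc2, hc3⟩ := d.tau_ne (left_ne_zero_of_mul hc)
  have := d.M_lt j
  have := d.chi_uniq (by rw [abs_lt]; omega) hb3 hc3
  omega

lemma st_zero1 (j : ℕ) (x : ℝ) : d.tau j (x + α) * d.sig j x = 0 := by
  by_contra hc
  obtain ⟨b, hb1, hb2, hb3⟩ := d.sig_ne (right_ne_zero_of_mul hc)
  obtain ⟨c, hc1, hc2, hc3⟩ := d.tau_ne (left_ne_zero_of_mul hc)
  have h4 : chi (d.N j) (x + (c + 1 : ℤ) * α) ≠ 0 := by
    rw [show x + ((c + 1 : ℤ) : ℝ) * α = x + α + c * α by push_cast; ring]; exact hc3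
  have := d.M_lt j
  have := d.chi_uniq (by rw [abs_lt]; omega) hb3 h4
  omega

lemma st_zero2 {j : ℕ} {x : ℝ} (hx : chi (d.N j) x = 0) : d.tau j x * d.sig j (x + α) = 0 := by
  by_contra hc
  obtain ⟨b, hb1, hb2, hb3⟩ := d.sig_ne (right_ne_zero_of_mul hc)
  obtain ⟨c, hc1, hc2, hc3⟩ := d.tau_ne (left_ne_zero_of_mul hc)
  have h4 : chi (d.N j) (x + (1 - b : ℤ) * α) ≠ 0 := by
    rw [show x + ((1 - b : ℤ) : ℝ) * α = x + α + ((-b : ℤ) : ℝ) * α by push_cast; ring]; exact hb3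
  have := d.M_lt j
  have := d.chi_uniq (by rw [abs_lt]; omega) h4 hc3
  have : c = 0 := by omega
  subst this
  simp [hx] at hc3

lemma at_hit {j : ℕ} {x : ℝ} (hx : chi (d.N j) x ≠ 0) :
    d.sig j x = 0 ∧ d.tau j (x + α) = 0 ∧ d.Sc j x = 0 ∧ d.Tc j x = 0 := by
  have hM := d.M_lt j
  have hM1 := d.M_pos j
  have hx0 : chi (d.N j) (x + (0 : ℤ) * α) ≠ 0 := by simpa using hx
  refine ⟨?_, ?_, ?_, ?_⟩
  · by_contra hc
    obtain ⟨b, hb1, hb2, hb3⟩ := d.sig_ne hc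
    have := d.chi_uniq (by rw [abs_lt]; omega) hb3 hx0
    omega
  · by_contra hc
    obtain ⟨c, hc1, hc2, hc3⟩ := d.tau_ne hc
    have h4 : chi (d.N j) (x + (c + 1 : ℤ) * α) ≠ 0 := by
      rw [show x + ((c + 1 : ℤ) : ℝ) * α = x + α + c * α by push_cast; ring]; exact hc3
    have := d.chi_uniq (by rw [abs_lt]; omega) hx0 h4
    omega
  · unfold Sc S
    rw [d.G_zero, mul_zero]
    by_contra hc
    have h4 : chi (d.N j) (x + (-(d.M j : ℤ) : ℤ) * α) ≠ 0 := by
      rw [show x + ((-(d.M j : ℤ) : ℤ) : ℝ) * α = x - d.M j * α by push_cast; ring]; exact hc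
    have := d.chi_uniq (by rw [abs_lt]; omega) hx0 h4
    omega
  · unfold Tc T
    rw [d.G_zero, mul_zero]
    by_contra hc
    have h4 : chi (d.N j) (x + ((d.M j : ℤ) : ℤ) * α) ≠ 0 := by
      rw [show x + (((d.M j : ℤ) : ℤ) : ℝ) * α = x + d.M j * α by push_cast; ring]; exact hc
    have := d.chi_uniq (by rw [abs_lt]; omega) hx0 h4
    omega

lemma at_hit2 {j : ℕ} {x : ℝ} (hx : chi (d.N j) x ≠ 0) :
    d.sig j (x + α) = Real.exp (-2000) * d.G j x ∧ d.tau j x = d.G j x := by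
  obtain ⟨h1, h2, h3, h4⟩ := d.at_hit hx
  rw [d.sig_rec, d.tau_rec, h1, h2, h3, h4]
  constructor <;> ring

def U (j : ℕ) (x : ℝ) : Matrix (Fin 2) (Fin 2) ℝ := !![1, d.tau j x; d.sig j x, 1]

def F : ℕ → ℝ → Matrix (Fin 2) (Fin 2) ℝ
  | 0, _ => 1
  | j + 1, x => F j x * d.U j x

lemma U_det (j : ℕ) (x : ℝ) : (d.U j x).det = 1 := by
  unfold U
  rw [Matrix.det_fin_two_of, d.st_zero]; ring

lemma F_det (j : ℕ) (x : ℝ) : (d.F j x).det = 1 := by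
  induction j with
  | zero => simp [F]
  | succ j ih => rw [F, Matrix.det_mul, ih, U_det, one_mul]

lemma F_adj (j : ℕ) (x : ℝ) : (d.F j x).adjugate * d.F j x = 1 := by
  rw [Matrix.adjugate_mul, F_det, one_smul]

lemma F_adj' (j : ℕ) (x : ℝ) : d.F j x * (d.F j x).adjugate = 1 := by
  rw [Matrix.mul_adjugate, F_det, one_smul]

/-- one step of the telescoping at points of the bump -/
lemma F_hit_step {j : ℕ} {x Ψ : ℝ} (hx : chi (d.N j) x ≠ 0)
    (h1 : d.F j x = !![1, Real.exp (d.H j) - 1; 0, 1])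
    (h2 : d.F j (x + α) = !![1, 0; Real.exp (-2000) * (Real.exp (d.H j) - 1), 1])
    (hΨ : Ψ = d.H j + d.h j * chi (d.N j) x) :
    d.F (j + 1) x = !![1, Real.exp Ψ - 1; 0, 1] ∧
    d.F (j + 1) (x + α) = !![1, 0; Real.exp (-2000) * (Real.exp Ψ - 1), 1] := by
  obtain ⟨e1, e2, e3, e4⟩ := d.at_hit hx
  obtain ⟨e5, e6⟩ := d.at_hit2 hx
  have e7 : d.G j x = Real.exp Ψ - Real.exp (d.H j) := by
    unfold G; rw [hΨ, Real.exp_add]; ring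
  rw [F, F, h1, h2, U, U, e1, e2, e5, e6, e7]
  constructor
  · ext a b; fin_cases a <;> fin_cases b <;> simp [Matrix.mul_apply, Fin.sum_univ_two]
  · ext a b; fin_cases a <;> fin_cases b <;> simp [Matrix.mul_apply, Fin.sum_univ_two]; ring

lemma F_hit_aux (x : ℝ) (m : ℕ) (h : ∀ i < m, chi (d.N i) x = 1) :
    d.F m x = !![1, Real.exp (d.H m) - 1; 0, 1] ∧
    d.F m (x + α) = !![1, 0; Real.exp (-2000) * (Real.exp (d.H m) - 1), 1] := by
  induction m with
  | zero => simp [F, H, Matrix.one_fin_two]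
  | succ m ih =>
    obtain ⟨h1, h2⟩ := ih fun i hi => h i (by omega)
    refine d.F_hit_step (by rw [h m (by omega)]; norm_num) h1 h2 ?_
    rw [h m (by omega), d.H_succ]; ring

lemma F_hit {j : ℕ} {x : ℝ} (hx : chi (d.N j) x ≠ 0) :
    d.F j x = !![1, Real.exp (d.H j) - 1; 0, 1] ∧
    d.F j (x + α) = !![1, 0; Real.exp (-2000) * (Real.exp (d.H j) - 1), 1] :=
  d.F_hit_aux x j fun _ hi => d.chi_nested hi hx

def dg (j : ℕ) (x : ℝ) : Matrix (Fin 2) (Fin 2) ℝ := !![d.a j x, 0; 0, d.ai j x]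

def DD (j : ℕ) (x : ℝ) : Matrix (Fin 2) (Fin 2) ℝ :=
  d.F j (x + α) * d.dg j x * (d.F j x).adjugate

lemma DD_det (j : ℕ) (x : ℝ) : (d.DD j x).det = 1 := by
  have h : (d.dg j x).det = 1 := by
    unfold dg; rw [Matrix.det_fin_two_of]; have := d.a_ai j x; linarith
  have h2 : ((d.F j x).adjugate).det = 1 := by
    rw [Matrix.det_adjugate, d.F_det]; simp
  unfold DD
  rw [Matrix.det_mul, Matrix.det_mul, d.F_det, h, h2]; norm_num

end Towers

section LPs

def LN : Matrix (Fin 2) (Fin 2) ℝ :=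
  !![-Real.exp 1000, -Real.exp 1000; Real.exp (-1000), Real.exp (-1000)]

def LP (θ : ℝ) : Matrix (Fin 2) (Fin 2) ℝ :=
  !![Real.exp 1000 * θ, Real.exp 1000 * (θ - 1);
    Real.exp (-1000) * (1 - θ), Real.exp (-1000) * (2 - θ)]

lemma LP_sub (θ θ' : ℝ) : LP θ' = LP θ + (θ - θ') • LN := by
  unfold LP LN
  ext a b; fin_cases a <;> fin_cases b <;> simp <;> ring

lemma KK : Real.exp 1000 * Real.exp (-1000) = 1 := by
  rw [← Real.exp_add, add_neg_cancel, Real.exp_zero]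

lemma KK2 : Real.exp (-2000) = Real.exp (-1000) * Real.exp (-1000) := by
  rw [← Real.exp_add]; norm_num

lemma LP_det (θ : ℝ) : (LP θ).det = 1 := by
  unfold LP
  rw [Matrix.det_fin_two_of]
  linear_combination KK

variable {α : ℝ} (d : Dat α)

lemma DD_of_F {j : ℕ} {x Ψ : ℝ} (hΨ : d.psi j x = Ψ)
    (h1 : d.F j x = !![1, Real.exp Ψ - 1; 0, 1])
    (h2 : d.F j (x + α) = !![1, 0; Real.exp (-2000) * (Real.exp Ψ - 1), 1]) :
    d.DD j x = LP (Real.exp (-Ψ)) := by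
  unfold DD dg a ai LP
  rw [h1, h2, hΨ, neg_sub, Real.exp_sub, Real.exp_sub, Real.exp_neg Ψ, KK2]
  have hE := (Real.exp_pos Ψ).ne'
  have hK := (Real.exp_pos 1000).ne'
  rw [Real.exp_neg]
  generalize Real.exp Ψ = E at *
  generalize Real.exp 1000 = K at *
  rw [Matrix.adjugate_fin_two_of]
  ext a b; fin_cases a <;> fin_cases b <;> simp [Matrix.mul_apply, Fin.sum_univ_two] <;>
    field_simp <;> ring

lemma DD_hit {j : ℕ} {x : ℝ} (hx : chi (d.N j) x ≠ 0) :
    d.DD j x = LP (Real.exp (-d.H j)) :=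
  d.DD_of_F (d.psi_eq hx) (d.F_hit hx).1 (d.F_hit hx).2

lemma DD_hit' {j : ℕ} {x : ℝ} (hx : chi (d.N j) x ≠ 0) :
    d.DD (j + 1) x = LP (Real.exp (-(d.H j + d.h j * chi (d.N j) x))) := by
  have h := d.F_hit_step hx (d.F_hit hx).1 (d.F_hit hx).2 rfl
  refine d.DD_of_F ?_ h.1 h.2
  rw [d.psi_succ, d.psi_eq hx]

def Base (j : ℕ) (x : ℝ) : Matrix (Fin 2) (Fin 2) ℝ :=
  (Real.exp (-d.H j) - Real.exp (-(d.H j + d.h j * chi (d.N j) x))) • LN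

def Cut (j : ℕ) (x : ℝ) : Matrix (Fin 2) (Fin 2) ℝ :=
  d.F j (x + α) * !![0, d.a j x * d.Tc j x; -(d.a j x * d.Sc j x), 0] * (d.F j x).adjugate

lemma key_identity (j : ℕ) (x : ℝ) : d.DD (j + 1) x - d.DD j x = d.Base j x + d.Cut j x := by
  by_cases hx : chi (d.N j) x = 0
  · have hB : d.Base j x = 0 := by unfold Base; rw [hx]; simp
    have hpsi : d.psi (j + 1) x = d.psi j x := by rw [d.psi_succ, hx]; ring
    have hdg : d.dg (j + 1) x = d.dg j x := by unfold dg a ai; rw [hpsi]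
    have key : d.U j (x + α) * d.dg j x * (d.U j x).adjugate =
        d.dg j x + !![0, d.a j x * d.Tc j x; -(d.a j x * d.Sc j x), 0] := by
      have h1 := d.sig_rec j x
      have h2 := d.tau_rec j x
      have h3 := d.a_ai j x
      have h4 := d.st_zero1 j x
      have h5 := d.st_zero2 hx
      rw [d.G_zero hx] at h1 h2
      unfold U dg
      rw [Matrix.adjugate_fin_two_of]
      ext a b; fin_cases a <;> fin_cases b <;> simp [Matrix.mul_apply, Fin.sum_univ_two]
      · rcases mul_eq_zero.1 h4 with h | h <;> simp [h]
      · linear_combination (-d.a j x) * h2 - d.ai j x * d.tau j (x + α) * h3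
      · linear_combination (d.a j x) * h1 + d.ai j x * d.sig j x * h3
      · rcases mul_eq_zero.1 h5 with h | h <;> simp [h]
    rw [hB, zero_add]
    unfold DD Cut
    rw [F, F, hdg, Matrix.adjugate_mul_distrib]
    have e : d.F j (x + α) * d.U j (x + α) * d.dg j x * ((d.U j x).adjugate * (d.F j x).adjugate)
        = d.F j (x + α) * (d.U j (x + α) * d.dg j x * (d.U j x).adjugate) * (d.F j x).adjugate := by
      simp only [Matrix.mul_assoc]
    rw [e, key, Matrix.mul_add, Matrix.add_mul]
    abel
  · have hC : d.Cut j x = 0 := by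
      obtain ⟨h1, h2, h3, h4⟩ := d.at_hit hx
      unfold Cut; rw [h3, h4]
      have : (!![0, d.a j x * 0; -(d.a j x * 0), 0] : Matrix (Fin 2) (Fin 2) ℝ) = 0 := by
        ext a b; fin_cases a <;> fin_cases b <;> simp
      rw [this]; simp
    rw [hC, add_zero, d.DD_hit hx, d.DD_hit' hx, LP_sub (Real.exp (-d.H j))]
    unfold Base
    abel

/-- the perturbations -/
def AA (j : ℕ) (x : ℝ) : Matrix (Fin 2) (Fin 2) ℝ :=
  d.DD j x + (Real.exp (-d.H j) * chi (d.N j) x) • LN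

lemma AA_nohit {j : ℕ} {x : ℝ} (hx : chi (d.N j) x = 0) : d.AA j x = d.DD j x := by
  unfold AA; rw [hx]; simp

lemma AA_hit {j : ℕ} {x : ℝ} (hx : chi (d.N j) x ≠ 0) :
    d.AA j x = LP (Real.exp (-d.H j) * (1 - chi (d.N j) x)) := by
  unfold AA
  rw [d.DD_hit hx, LP_sub (Real.exp (-d.H j)) (Real.exp (-d.H j) * (1 - chi (d.N j) x))]
  congr 2; ring

lemma AA_det (j : ℕ) (x : ℝ) : (d.AA j x).det = 1 := by
  by_cases hx : chi (d.N j) x = 0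
  · rw [d.AA_nohit hx, d.DD_det]
  · rw [d.AA_hit hx, LP_det]

def Qm (H c : ℝ) : Matrix (Fin 2) (Fin 2) ℝ :=
  !![Real.exp 1000 * (Real.exp (-H) * (1 - c)), -(Real.exp 1000 * c);
    Real.exp (-1000) * c, Real.exp (-1000) * (Real.exp H * (1 + c))]

lemma AA_Q {j : ℕ} {x : ℝ} (hx : chi (d.N j) x ≠ 0) :
    d.AA j x = d.F j (x + α) * Qm (d.H j) (chi (d.N j) x) * (d.F j x).adjugate := by
  rw [d.AA_hit hx, (d.F_hit hx).1, (d.F_hit hx).2]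
  unfold LP Qm
  rw [Matrix.adjugate_fin_two_of, KK2, Real.exp_neg (d.H j)]
  have hE := (Real.exp_pos (d.H j)).ne'
  have hK := (Real.exp_pos 1000).ne'
  rw [Real.exp_neg]
  generalize Real.exp (d.H j) = E at *
  generalize Real.exp 1000 = K at *
  ext a b; fin_cases a <;> fin_cases b <;> simp [Matrix.mul_apply, Fin.sum_univ_two] <;>
    field_simp <;> ring

end LPs
end Dat

lemma Bdi.weaken {s r : ℕ} {C : ℝ} {f : ℝ → ℝ} (h : Bdi 0 r C f) : Bdi s r C f :=
  ⟨h.1, fun k _ h2 x => h.2 k (Nat.zero_le _) h2 x⟩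

namespace Dat
section Est
variable {α : ℝ} (d : Dat α) {r : ℕ} {b : ℝ}

lemma psi_bdi (hb : 1 ≤ b) (hchi : ∀ N : ℕ, 0 < N → Bdi 0 r (b * (N : ℝ) ^ r) (chi N)) (j : ℕ) :
    Bdi 1 r (b * (d.N j : ℝ) ^ (r + 1)) (d.psi j) := by
  have hN := d.N_geR j
  have h1 : Bdi 1 r (∑ i ∈ Finset.range j, d.h i * (b * (d.N j : ℝ) ^ r)) (d.psi j) := by
    refine bdi_sum j fun i hi => ?_
    have h2 := ((hchi _ (d.N_pos i)).smul (d.h i)).weaken (s := 1)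
    rw [abs_of_nonneg (d.h_nonneg i)] at h2
    refine h2.mono ?_
    have h3 := d.N_mono hi
    have h4 : (d.N i : ℝ) ^ r ≤ (d.N j : ℝ) ^ r :=
      pow_le_pow_left₀ (by positivity) (by linarith [d.N_geR i]) r
    have := d.h_nonneg i
    gcongr
  refine h1.mono ?_
  rw [← Finset.sum_mul]
  have h5 : d.H j ≤ d.N j := by have := d.H_le j; linarith
  have h6 := d.H_nonneg j
  unfold H at h5 h6
  calc _ ≤ (d.N j : ℝ) * (b * (d.N j : ℝ) ^ r) := by gcongr
    _ = _ := by ring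

/-- polynomial prefactor -/
def Pf (r : ℕ) (b : ℝ) (j : ℕ) : ℝ := 2 * (r.factorial * (3 * b * (d.N j : ℝ) ^ (r + 2)) ^ r)

lemma G_exp (E : ℝ → ℝ) (j : ℕ) (y : ℝ) : Real.exp (E y) * d.G j y =
    Real.exp (E y + (d.H j + d.h j * chi (d.N j) y)) - Real.exp (E y + d.H j) := by
  unfold G
  rw [Real.exp_add, Real.exp_add, Real.exp_add]; ring

lemma tower_bdi (hb : 1 ≤ b) (hchi : ∀ N : ℕ, 0 < N → Bdi 0 r (b * (N : ℝ) ^ r) (chi N)) (j : ℕ)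
    {E : ℝ → ℝ} {B : ℝ} (hE : Bdi 1 r (2 * b * (d.N j : ℝ) ^ (r + 2)) E)
    (hB : ∀ y, E y + (d.H j + d.h j) ≤ B) :
    Bdi 0 r (d.Pf r b j * Real.exp B) (fun y => Real.exp (E y) * d.G j y) := by
  have hN := d.N_geR j
  have hN1 : (1 : ℝ) ≤ d.N j := by linarith
  have hpow : (1 : ℝ) ≤ (d.N j : ℝ) ^ (r + 2) := one_le_pow₀ hN1
  have hpow2 : (d.N j : ℝ) ^ (r + 1) ≤ (d.N j : ℝ) ^ (r + 2) := pow_le_pow_right₀ hN1 (by omega)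
  have hD : 1 ≤ 3 * b * (d.N j : ℝ) ^ (r + 2) := by nlinarith
  have hx : Bdi 1 r (b * (d.N j : ℝ) ^ (r + 2)) (fun y => d.h j * chi (d.N j) y) := by
    have h2 := ((hchi _ (d.N_pos j)).smul (d.h j)).weaken (s := 1)
    rw [abs_of_nonneg (d.h_nonneg j)] at h2
    refine h2.mono ?_
    have := d.h_le j
    calc d.h j * (b * (d.N j : ℝ) ^ r) ≤ d.N j * (b * (d.N j : ℝ) ^ r) := by gcongr
      _ = b * (d.N j : ℝ) ^ (r + 1) := by ring
      _ ≤ _ := by gcongr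
  have h1 : Bdi 1 r (3 * b * (d.N j : ℝ) ^ (r + 2))
      (fun y => E y + (d.H j + d.h j * chi (d.N j) y)) := by
    refine (hE.add ((bdi1_const le_rfl).add hx)).mono (le_of_eq ?_)
    ring
  have h2 : Bdi 1 r (3 * b * (d.N j : ℝ) ^ (r + 2)) (fun y => E y + d.H j) := by
    refine (hE.add (bdi1_const le_rfl)).mono ?_
    nlinarith
  have h3 := h1.exp hD (B := B) fun y => by
    refine le_trans ?_ (hB y)
    have := mul_le_of_le_one_right (d.h_nonneg j) (chi_le_one (d.N j) y)
    linarith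
  have h4 := h2.exp hD (B := B) fun y => by
    refine le_trans ?_ (hB y)
    linarith [d.h_nonneg j]
  have h5 := h3.sub h4
  simp only [d.G_exp]
  refine h5.mono (le_of_eq ?_)
  unfold Pf; ring

lemma S_bdi (hb : 1 ≤ b) (hchi : ∀ N : ℕ, 0 < N → Bdi 0 r (b * (N : ℝ) ^ r) (chi N)) (j : ℕ)
    {k : ℕ} (hk : k ≤ d.N j) :
    Bdi 0 r (d.Pf r b j * Real.exp (2 * d.N j - 1998 * k)) (d.S j k) := by
  have hN := d.N_geR j
  have hkR : (k : ℝ) ≤ d.N j := by exact_mod_cast hk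
  refine d.tower_bdi hb hchi j (E := fun y => -2000 * ((k + 1 : ℕ) : ℝ) +
    2 * ∑ l ∈ Finset.range k, d.psi j (y + ((l + 1 : ℕ) : ℝ) * α)) ?_ ?_
  · have h1 := (bdi_sum (s := 1) (r := r) (c := fun _ => b * (d.N j : ℝ) ^ (r + 1))
      (F := fun l y => d.psi j (y + ((l + 1 : ℕ) : ℝ) * α)) k
      fun l _ => (d.psi_bdi hb hchi j).shift _).smul 2
    refine ((bdi1_const (c := -2000 * ((k + 1 : ℕ) : ℝ)) le_rfl).add h1).mono ?_
    simp only [Finset.sum_const, Finset.card_range, nsmul_eq_mul, abs_two, zero_add]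
    calc 2 * ((k : ℝ) * (b * (d.N j : ℝ) ^ (r + 1)))
        ≤ 2 * (d.N j * (b * (d.N j : ℝ) ^ (r + 1))) := by gcongr
      _ = _ := by ring
  · intro y
    have h1 := d.psi_sum_le j k (y + α)
    have h2 : ∑ l ∈ Finset.range k, d.psi j (y + ((l + 1 : ℕ) : ℝ) * α) =
        ∑ l ∈ Finset.range k, d.psi j (y + α + l * α) := by
      refine Finset.sum_congr rfl fun l _ => ?_
      congr 1; push_cast; ring
    simp only [h2]
    have := d.H_le j
    have := d.h_le j
    push_cast
    linarith

lemma T_bdi (hb : 1 ≤ b) (hchi : ∀ N : ℕ, 0 < N → Bdi 0 r (b * (N : ℝ) ^ r) (chi N)) (j : ℕ)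
    {k : ℕ} (hk : k ≤ d.N j) :
    Bdi 0 r (d.Pf r b j * Real.exp (2 * d.N j - 1998 * k)) (d.T j k) := by
  have hN := d.N_geR j
  have hkR : (k : ℝ) ≤ d.N j := by exact_mod_cast hk
  refine d.tower_bdi hb hchi j (E := fun y => -2000 * (k : ℝ) +
    2 * ∑ l ∈ Finset.range k, d.psi j (y - ((l + 1 : ℕ) : ℝ) * α)) ?_ ?_
  · have h1 := (bdi_sum (s := 1) (r := r) (c := fun _ => b * (d.N j : ℝ) ^ (r + 1))
      (F := fun l y => d.psi j (y - ((l + 1 : ℕ) : ℝ) * α)) k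
      fun l _ => (d.psi_bdi hb hchi j).shift_sub _).smul 2
    refine ((bdi1_const (c := -2000 * (k : ℝ)) le_rfl).add h1).mono ?_
    simp only [Finset.sum_const, Finset.card_range, nsmul_eq_mul, abs_two, zero_add]
    calc 2 * ((k : ℝ) * (b * (d.N j : ℝ) ^ (r + 1)))
        ≤ 2 * (d.N j * (b * (d.N j : ℝ) ^ (r + 1))) := by gcongr
      _ = _ := by ring
  · intro y
    have h1 := d.psi_sum_le' j k y
    have := d.H_le j
    have := d.h_le j
    linarith

def cc (r : ℕ) (b : ℝ) : ℝ :=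
  2 * (r.factorial * (3 * b) ^ r) * (((r + 2) * r + 1).factorial : ℝ)

lemma fact_ge_one (m : ℕ) : (1 : ℝ) ≤ m.factorial := by
  exact_mod_cast Nat.one_le_iff_ne_zero.2 (Nat.factorial_ne_zero m)

lemma cc_ge (hb : 1 ≤ b) : 1 ≤ cc r b := by
  have h1 := fact_ge_one r
  have h2 := fact_ge_one ((r + 2) * r + 1)
  have h3 : (1 : ℝ) ≤ (3 * b) ^ r := one_le_pow₀ (by linarith)
  unfold cc
  have h4 : 1 ≤ r.factorial * (3 * b) ^ r := one_le_mul_of_one_le_of_one_le h1 h3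
  nlinarith

lemma NPf_le (hb : 1 ≤ b) (j : ℕ) : d.N j * d.Pf r b j ≤ cc r b * Real.exp (d.N j) := by
  have h1 := Real.pow_div_factorial_le_exp (d.N j : ℝ) (by positivity) ((r + 2) * r + 1)
  rw [div_le_iff₀ (by positivity)] at h1
  unfold Pf cc
  have e : (d.N j : ℝ) * (2 * (r.factorial * (3 * b * (d.N j : ℝ) ^ (r + 2)) ^ r)) =
      2 * (r.factorial * (3 * b) ^ r) * (d.N j : ℝ) ^ ((r + 2) * r + 1) := by
    rw [pow_succ _ ((r + 2) * r), pow_mul, mul_pow]; ring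
  rw [e, mul_assoc _ _ (Real.exp _), mul_comm _ (Real.exp _)]
  exact mul_le_mul_of_nonneg_left h1 (by positivity)

lemma Pf_nonneg (hb : 1 ≤ b) (j : ℕ) : 0 ≤ d.Pf r b j := by unfold Pf; positivity

lemma Pf_le (hb : 1 ≤ b) (j : ℕ) : d.Pf r b j ≤ cc r b * Real.exp (d.N j) := by
  refine le_trans ?_ (d.NPf_le hb j)
  have := d.Pf_nonneg (r := r) hb j
  nlinarith [d.N_geR j]

lemma sum_tower (hb : 1 ≤ b) (j : ℕ) :
    ∑ k ∈ Finset.range (d.M j), d.Pf r b j * Real.exp (2 * d.N j - 1998 * k) ≤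
      cc r b * Real.exp (3 * d.N j) := by
  have hP := d.Pf_nonneg (r := r) hb j
  calc _ ≤ ∑ k ∈ Finset.range (d.M j), d.Pf r b j * Real.exp (2 * d.N j) := by
        refine Finset.sum_le_sum fun k _ => ?_
        have : Real.exp (2 * d.N j - 1998 * k) ≤ Real.exp (2 * d.N j) :=
          Real.exp_le_exp.2 (by have : (0 : ℝ) ≤ k := by positivity
                                linarith)
        gcongr
    _ = (d.M j : ℝ) * d.Pf r b j * Real.exp (2 * d.N j) := by simp; ring
    _ ≤ d.N j * d.Pf r b j * Real.exp (2 * d.N j) := by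
        have : (d.M j : ℝ) ≤ d.N j := by
          exact_mod_cast (by have := d.M_lt j; omega : d.M j ≤ d.N j)
        gcongr
    _ ≤ cc r b * Real.exp (d.N j) * Real.exp (2 * d.N j) :=
        mul_le_mul_of_nonneg_right (d.NPf_le hb j) (Real.exp_pos _).le
    _ = _ := by
        rw [mul_assoc, ← Real.exp_add]; congr 2; ring

lemma sig_bdi (hb : 1 ≤ b) (hchi : ∀ N : ℕ, 0 < N → Bdi 0 r (b * (N : ℝ) ^ r) (chi N)) (j : ℕ) :
    Bdi 0 r (cc r b * Real.exp (3 * d.N j)) (d.sig j) := by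
  refine Bdi.mono (bdi_sum (d.M j) fun k hk => ?_) (d.sum_tower hb j)
  exact (d.S_bdi hb hchi j (by have := d.M_lt j; omega)).shift_sub _

lemma tau_bdi (hb : 1 ≤ b) (hchi : ∀ N : ℕ, 0 < N → Bdi 0 r (b * (N : ℝ) ^ r) (chi N)) (j : ℕ) :
    Bdi 0 r (cc r b * Real.exp (3 * d.N j)) (d.tau j) := by
  refine Bdi.mono (bdi_sum (d.M j) fun k hk => ?_) (d.sum_tower hb j)
  exact (d.T_bdi hb hchi j (by have := d.M_lt j; omega)).shift _

lemma cut_le (hb : 1 ≤ b) (j : ℕ) : d.Pf r b j * Real.exp (2 * d.N j - 1998 * d.M j) ≤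
    cc r b * Real.exp (-246 * d.N j) := by
  have h1 : (d.N j : ℝ) ≤ 8 * d.M j := by
    exact_mod_cast (by unfold M; have := d.N_ge j; omega : d.N j ≤ 8 * d.M j)
  have hc : 0 ≤ cc r b := by linarith [cc_ge (r := r) hb]
  calc _ ≤ cc r b * Real.exp (d.N j) * Real.exp (2 * d.N j - 1998 * d.M j) :=
        mul_le_mul_of_nonneg_right (d.Pf_le hb j) (Real.exp_pos _).le
    _ = cc r b * Real.exp (d.N j + (2 * d.N j - 1998 * d.M j)) := by
        rw [mul_assoc, ← Real.exp_add]
    _ ≤ _ := by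
        refine mul_le_mul_of_nonneg_left (Real.exp_le_exp.2 ?_) hc
        linarith

lemma Sc_bdi (hb : 1 ≤ b) (hchi : ∀ N : ℕ, 0 < N → Bdi 0 r (b * (N : ℝ) ^ r) (chi N)) (j : ℕ) :
    Bdi 0 r (cc r b * Real.exp (-246 * d.N j)) (d.Sc j) :=
  ((d.S_bdi hb hchi j (by have := d.M_lt j; omega)).shift_sub _).mono (d.cut_le hb j)

lemma Tc_bdi (hb : 1 ≤ b) (hchi : ∀ N : ℕ, 0 < N → Bdi 0 r (b * (N : ℝ) ^ r) (chi N)) (j : ℕ) :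
    Bdi 0 r (cc r b * Real.exp (-246 * d.N j)) (d.Tc j) :=
  ((d.T_bdi hb hchi j (by have := d.M_lt j; omega)).shift _).mono (d.cut_le hb j)

lemma a_aux (hb : 1 ≤ b) (hchi : ∀ N : ℕ, 0 < N → Bdi 0 r (b * (N : ℝ) ^ r) (chi N)) (j : ℕ)
    {E : ℝ → ℝ} (hE : Bdi 1 r (b * (d.N j : ℝ) ^ (r + 1)) E) (hE2 : ∀ x, E x ≤ 1000 + d.N j) :
    Bdi 0 r (cc r b * Real.exp (1000 + 2 * d.N j)) (fun x => Real.exp (E x)) := by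
  have hN := d.N_geR j
  have hN1 : (1 : ℝ) ≤ d.N j := by linarith
  have hpow : (1 : ℝ) ≤ (d.N j : ℝ) ^ (r + 2) := one_le_pow₀ hN1
  have hpow2 : (d.N j : ℝ) ^ (r + 1) ≤ (d.N j : ℝ) ^ (r + 2) := pow_le_pow_right₀ hN1 (by omega)
  have hD : 1 ≤ 3 * b * (d.N j : ℝ) ^ (r + 2) := by nlinarith
  have h1 := (hE.mono (by nlinarith : _ ≤ 3 * b * (d.N j : ℝ) ^ (r + 2))).exp hD hE2
  refine h1.mono ?_
  calc _ = (d.Pf r b j / 2) * Real.exp (1000 + d.N j) := by unfold Pf; ring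
    _ ≤ (cc r b * Real.exp (d.N j)) * Real.exp (1000 + d.N j) := by
        refine mul_le_mul_of_nonneg_right ?_ (Real.exp_pos _).le
        linarith [d.Pf_le (r := r) hb j, d.Pf_nonneg (r := r) hb j]
    _ = _ := by rw [mul_assoc, ← Real.exp_add]; congr 2; ring

lemma a_bdi (hb : 1 ≤ b) (hchi : ∀ N : ℕ, 0 < N → Bdi 0 r (b * (N : ℝ) ^ r) (chi N)) (j : ℕ) :
    Bdi 0 r (cc r b * Real.exp (1000 + 2 * d.N j)) (d.a j) := by
  refine d.a_aux hb hchi j ?_ ?_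
  · exact ((bdi1_const le_rfl).sub (d.psi_bdi hb hchi j)).mono (by simp)
  · intro x
    have := d.psi_nonneg j x
    have := d.N_geR j
    linarith

lemma ai_bdi (hb : 1 ≤ b) (hchi : ∀ N : ℕ, 0 < N → Bdi 0 r (b * (N : ℝ) ^ r) (chi N)) (j : ℕ) :
    Bdi 0 r (cc r b * Real.exp (1000 + 2 * d.N j)) (d.ai j) := by
  refine d.a_aux hb hchi j ?_ ?_
  · exact (((bdi1_const le_rfl).sub (d.psi_bdi hb hchi j)).neg).mono (by simp)
  · intro x
    have := d.psi_le j x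
    have := d.H_le j
    have := d.N_geR j
    linarith

lemma U_bdM (hb : 1 ≤ b) (hchi : ∀ N : ℕ, 0 < N → Bdi 0 r (b * (N : ℝ) ^ r) (chi N)) (j : ℕ) :
    BdM r (cc r b * Real.exp (3 * d.N j)) (d.U j) := by
  have h1 : |(1 : ℝ)| ≤ cc r b * Real.exp (3 * d.N j) := by
    rw [abs_one]
    refine one_le_mul_of_one_le_of_one_le (cc_ge hb) (Real.one_le_exp (by positivity))
  exact bdM_of (bdi_const h1) (d.tau_bdi hb hchi j) (d.sig_bdi hb hchi j) (bdi_const h1)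

lemma F_bdM (hb : 1 ≤ b) (hchi : ∀ N : ℕ, 0 < N → Bdi 0 r (b * (N : ℝ) ^ r) (chi N)) (j : ℕ) :
    BdM r ((2 ^ (r + 1) * cc r b) ^ j * Real.exp (d.N j / 333)) (d.F j) := by
  have h : BdM r ((2 ^ (r + 1) * cc r b) ^ j *
      Real.exp (3 * ∑ i ∈ Finset.range j, (d.N i : ℝ))) (d.F j) := by
    induction j with
    | zero =>
      simp only [pow_zero, Finset.range_zero, Finset.sum_empty, mul_zero, Real.exp_zero, mul_one]
      refine bdM_const 1 fun a b => ?_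
      fin_cases a <;> fin_cases b <;> simp
    | succ j ih =>
      refine (ih.mul (d.U_bdM hb hchi j)).mono (le_of_eq ?_)
      rw [Finset.sum_range_succ, mul_add, Real.exp_add]; ring
  refine h.mono ?_
  have hc := cc_ge (r := r) hb
  refine mul_le_mul_of_nonneg_left (Real.exp_le_exp.2 ?_) (by positivity)
  linarith [d.sumN_le j]

lemma cut_bdM (hb : 1 ≤ b) (hchi : ∀ N : ℕ, 0 < N → Bdi 0 r (b * (N : ℝ) ^ r) (chi N)) :
    ∃ C c : ℝ, 1 ≤ c ∧ 0 ≤ C ∧ ∀ j, BdM r (C * c ^ j * Real.exp (-240 * d.N j)) (d.Cut j) := by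
  have hc := cc_ge (r := r) hb
  have h2 : (1 : ℝ) ≤ 2 ^ (r + 1) := one_le_pow₀ (by norm_num)
  set c := 2 ^ (r + 1) * cc r b with hcdef
  have hc1 : 1 ≤ c := one_le_mul_of_one_le_of_one_le h2 hc
  refine ⟨2 ^ (r + 1) * (2 ^ (r + 1) * (2 ^ r * (cc r b * Real.exp 1000) * cc r b)), c ^ 2,
    one_le_pow₀ hc1, by positivity, fun j => ?_⟩
  have hF := d.F_bdM hb hchi j
  rw [← hcdef] at hF
  have hT := (d.a_bdi hb hchi j).mul (d.Tc_bdi hb hchi j)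
  have hS := (d.a_bdi hb hchi j).mul (d.Sc_bdi hb hchi j)
  have h0 : Bdi 0 r (2 ^ r * (cc r b * Real.exp (1000 + 2 * d.N j)) *
      (cc r b * Real.exp (-246 * d.N j))) (fun _ => (0 : ℝ)) :=
    bdi_const (by rw [abs_zero]; exact hT.nonneg)
  have h := ((hF.shift α).mul (bdM_of h0 hT hS.neg h0)).mul hF.adj
  refine BdM.mono h ?_
  have e : 2 ^ (r + 1) * (2 ^ (r + 1) * (c ^ j * Real.exp (d.N j / 333)) *
      (2 ^ r * (cc r b * Real.exp (1000 + 2 * d.N j)) * (cc r b * Real.exp (-246 * d.N j)))) *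
      (c ^ j * Real.exp (d.N j / 333)) =
      2 ^ (r + 1) * (2 ^ (r + 1) * (2 ^ r * (cc r b * Real.exp 1000) * cc r b)) * (c ^ 2) ^ j *
      Real.exp (d.N j / 333 + 2 * d.N j + -246 * d.N j + d.N j / 333) := by
    rw [← pow_mul, Real.exp_add, Real.exp_add, Real.exp_add, Real.exp_add]; ring
  rw [e]
  refine mul_le_mul_of_nonneg_left (Real.exp_le_exp.2 ?_) (by positivity)
  have := d.N_geR j
  linarith

lemma LN_le (a b : Fin 2) : |LN a b| ≤ Real.exp 1000 := by
  have h1 : |Real.exp (-1000)| ≤ Real.exp 1000 := by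
    rw [abs_of_pos (Real.exp_pos _)]; exact Real.exp_le_exp.2 (by norm_num)
  unfold LN
  fin_cases a <;> fin_cases b <;> simp

lemma smul_LN {C : ℝ} {f : ℝ → ℝ} (h : Bdi 0 r C f) :
    BdM r (Real.exp 1000 * C) (fun x => f x • LN) := by
  intro a b
  have h1 := h.smul (LN a b)
  have e : (fun x => (f x • LN) a b) = fun x => LN a b * f x := by
    funext x; simp [mul_comm]
  rw [e]
  exact h1.mono (mul_le_mul_of_nonneg_right (LN_le a b) h.nonneg)

lemma base_bdM (hb : 1 ≤ b) (hchi : ∀ N : ℕ, 0 < N → Bdi 0 r (b * (N : ℝ) ^ r) (chi N)) (j : ℕ) :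
    BdM r (Real.exp 1000 * (2 * r.factorial * b ^ r) *
      ((d.N j : ℝ) ^ ((r + 1) * r) * Real.exp (-d.H j))) (d.Base j) := by
  have hN := d.N_geR j
  have hN1 : (1 : ℝ) ≤ d.N j := by linarith
  have hpow : (1 : ℝ) ≤ (d.N j : ℝ) ^ (r + 1) := one_le_pow₀ hN1
  have hD : 1 ≤ b * (d.N j : ℝ) ^ (r + 1) := one_le_mul_of_one_le_of_one_le hb hpow
  have hx : Bdi 1 r (b * (d.N j : ℝ) ^ (r + 1))
      (fun y => -(d.H j + d.h j * chi (d.N j) y)) := by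
    have h2 := ((hchi _ (d.N_pos j)).smul (d.h j)).weaken (s := 1)
    rw [abs_of_nonneg (d.h_nonneg j)] at h2
    refine ((bdi1_const le_rfl).add h2).neg.mono ?_
    have := d.h_le j
    calc 0 + d.h j * (b * (d.N j : ℝ) ^ r) ≤ 0 + d.N j * (b * (d.N j : ℝ) ^ r) := by gcongr
      _ = b * (d.N j : ℝ) ^ (r + 1) := by ring
  have h3 := hx.exp hD (B := -d.H j) fun y => by
    have := mul_nonneg (d.h_nonneg j) (chi_nonneg (d.N j) y)
    linarith
  have h4 : Bdi 0 r (Real.exp (-d.H j)) (fun _ => Real.exp (-d.H j)) :=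
    bdi_const (by rw [abs_of_pos (Real.exp_pos _)])
  refine (smul_LN (h4.sub h3)).mono ?_
  rw [mul_assoc (Real.exp 1000)]
  refine mul_le_mul_of_nonneg_left ?_ (Real.exp_pos _).le
  have h5 : 1 ≤ r.factorial * (b * (d.N j : ℝ) ^ (r + 1)) ^ r :=
    one_le_mul_of_one_le_of_one_le (fact_ge_one r) (one_le_pow₀ hD)
  have h6 : (b * (d.N j : ℝ) ^ (r + 1)) ^ r = b ^ r * (d.N j : ℝ) ^ ((r + 1) * r) := by
    rw [mul_pow, pow_mul]
  have h7 := mul_le_mul_of_nonneg_right h5 (Real.exp_pos (-d.H j)).le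
  rw [h6] at *
  linarith

lemma N_two_pow (j : ℕ) : 2 ^ j ≤ d.N j := by
  induction j with
  | zero => have := d.N_ge 0; simp; omega
  | succ j ih => have := d.growth j; rw [pow_succ]; omega

lemma N_super (c : ℝ) {ε : ℝ} (hε : 0 < ε) : ∀ᶠ j : ℕ in atTop, c * j ≤ ε * d.N j := by
  have h1 := tendsto_pow_const_div_const_pow_of_one_lt 1 (by norm_num : (1 : ℝ) < 2)
  have h2 := (h1.const_mul |c|)
  rw [mul_zero] at h2
  filter_upwards [h2.eventually (ge_mem_nhds hε)] with j hj
  have h3 : ((2 : ℝ) ^ j) ≤ d.N j := by exact_mod_cast d.N_two_pow j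
  have h4 : (0 : ℝ) < 2 ^ j := by positivity
  rw [pow_one, ← mul_div_assoc, div_le_iff₀ h4] at hj
  have h5 : c * j ≤ |c| * j := mul_le_mul_of_nonneg_right (le_abs_self c) (by positivity)
  nlinarith

lemma pow_le_exp_N {c ε : ℝ} (hc : 1 ≤ c) (hε : 0 < ε) :
    ∀ᶠ j : ℕ in atTop, c ^ j ≤ Real.exp (ε * d.N j) := by
  filter_upwards [d.N_super (Real.log c) hε] with j hj
  have : c ^ j = Real.exp (Real.log c * j) := by
    rw [Real.exp_mul, Real.exp_log (by linarith), Real.rpow_natCast]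
  rw [this]
  exact Real.exp_le_exp.2 hj

lemma summable_cut {c : ℝ} (hc : 1 ≤ c) (C : ℝ) :
    Summable fun j => C * c ^ j * Real.exp (-240 * d.N j) := by
  simp only [mul_assoc C]
  refine Summable.mul_left C ?_
  refine Summable.of_norm_bounded_eventually_nat (g := fun j : ℕ => Real.exp (-j))
    Real.summable_exp_neg_nat ?_
  filter_upwards [d.pow_le_exp_N hc one_pos, d.N_super 1 one_pos] with j h1 h2
  rw [Real.norm_of_nonneg (by positivity)]
  calc _ ≤ Real.exp (1 * d.N j) * Real.exp (-240 * d.N j) :=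
        mul_le_mul_of_nonneg_right h1 (Real.exp_pos _).le
    _ = Real.exp (1 * d.N j + -240 * d.N j) := (Real.exp_add _ _).symm
    _ ≤ _ := Real.exp_le_exp.2 (by linarith [d.N_geR j])

lemma step_bdM (r : ℕ) : ∃ v : ℕ → ℝ, Summable v ∧
    ∀ j, BdM r (v j) (fun x => d.DD (j + 1) x - d.DD j x) := by
  obtain ⟨b, hb, hchi⟩ := chi_bdi r
  obtain ⟨C, c, hc, hC, h⟩ := d.cut_bdM hb hchi
  refine ⟨_, ((d.hbr ((r + 1) * r)).mul_left (Real.exp 1000 * (2 * r.factorial * b ^ r))).add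
    (d.summable_cut hc C), fun j => ?_⟩
  simp only [d.key_identity]
  exact (d.base_bdM hb hchi j).add (h j)

lemma DD_bdM (r j : ℕ) : ∃ C, BdM r C (d.DD j) := by
  obtain ⟨b, hb, hchi⟩ := chi_bdi r
  have hF := d.F_bdM hb hchi j
  have ha := d.a_bdi hb hchi j
  have h0 : Bdi 0 r (cc r b * Real.exp (1000 + 2 * d.N j)) (fun _ => (0 : ℝ)) :=
    bdi_const (by rw [abs_zero]; exact ha.nonneg)
  exact ⟨_, ((hF.shift α).mul (bdM_of ha h0 h0 (d.ai_bdi hb hchi j))).mul hF.adj⟩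

lemma DD_limit : ∃ D : ℝ → Matrix (Fin 2) (Fin 2) ℝ, ∀ r, ∃ w : ℕ → ℝ,
    Tendsto w atTop (nhds 0) ∧ ∀ j, BdM r (w j) (fun x => d.DD j x - D x) := by
  choose v hv hv2 using d.step_bdM
  have h : ∀ a b : Fin 2, ∃ g : ℝ → ℝ, ∀ r, ∃ w : ℕ → ℝ, Tendsto w atTop (nhds 0) ∧
      ∀ j, Bdi 0 r (w j) (fun x => d.DD j x a b - g x) := fun a b =>
    bdi_limit (f := fun j x => d.DD j x a b) hv (fun r j => hv2 r j a b)
  choose g hg using h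
  choose w hw hw2 using hg
  refine ⟨fun x a b => g a b x, fun r => ?_⟩
  refine ⟨fun j => ∑ a, ∑ b, w a b r j, ?_, fun j a b => ?_⟩
  · have : (0 : ℝ) = ∑ a : Fin 2, ∑ b : Fin 2, 0 := by simp
    rw [this]
    exact tendsto_finsetSum _ fun a _ => tendsto_finsetSum _ fun b _ => hw a b r
  · refine Bdi.mono (hw2 a b r j) ?_
    have hn : ∀ a b, 0 ≤ w a b r j := fun a b => (hw2 a b r j).nonneg
    calc w a b r j ≤ ∑ b, w a b r j :=
          Finset.single_le_sum (f := fun b => w a b r j) (fun b _ => hn a b) (Finset.mem_univ b)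
      _ ≤ _ := Finset.single_le_sum (f := fun a => ∑ b, w a b r j)
          (fun a _ => Finset.sum_nonneg fun b _ => hn a b) (Finset.mem_univ a)

lemma pert_bdM (r : ℕ) : ∃ w : ℕ → ℝ, Tendsto w atTop (nhds 0) ∧
    ∀ j, BdM r (w j) (fun x => d.AA j x - d.DD j x) := by
  obtain ⟨b, hb, hchi⟩ := chi_bdi r
  refine ⟨fun j => Real.exp 1000 * b * ((d.N j : ℝ) ^ r * Real.exp (-d.H j)), ?_, fun j => ?_⟩
  · have := ((d.hbr r).tendsto_atTop_zero).const_mul (Real.exp 1000 * b)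
    rw [mul_zero] at this
    exact this
  · have h1 := smul_LN ((hchi _ (d.N_pos j)).smul (Real.exp (-d.H j)))
    have e : (fun x => d.AA j x - d.DD j x) =
        fun x => (Real.exp (-d.H j) * chi (d.N j) x) • LN := by
      funext x; unfold AA; abel
    rw [e]
    refine h1.mono (le_of_eq ?_)
    rw [abs_of_pos (Real.exp_pos _)]; ring

lemma F_sup : ∀ᶠ j : ℕ in atTop, ∀ x a b, |d.F j x a b| ≤ Real.exp (d.N j / 250) := by
  obtain ⟨b, hb, hchi⟩ := chi_bdi 0
  have hc := cc_ge (r := 0) hb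
  filter_upwards [d.pow_le_exp_N (c := 2 ^ (0 + 1) * cc 0 b) (by norm_num; linarith)
    (by norm_num : (0 : ℝ) < 1 / 1100)] with j hj
  intro x a b'
  refine ((d.F_bdM hb hchi j a b').abs_le x).trans ?_
  calc _ ≤ Real.exp (1 / 1100 * d.N j) * Real.exp (d.N j / 333) :=
        mul_le_mul_of_nonneg_right hj (Real.exp_pos _).le
    _ = Real.exp (1 / 1100 * d.N j + d.N j / 333) := (Real.exp_add _ _).symm
    _ ≤ _ := Real.exp_le_exp.2 (by have := d.N_geR j; linarith)

end Est
end Dat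

namespace Dat
section Iter
variable {α : ℝ} (d : Dat α)

/-- exponent of the diagonal cocycle -/
def EE (j n : ℕ) (x : ℝ) : ℝ := 1000 * n - ∑ l ∈ Finset.range n, d.psi j (x + l * α)

def dE (E : ℝ) : Matrix (Fin 2) (Fin 2) ℝ := !![Real.exp E, 0; 0, Real.exp (-E)]

lemma dE_mul (E E' : ℝ) : dE E * dE E' = dE (E + E') := by
  unfold dE
  rw [neg_add, Real.exp_add, Real.exp_add]
  ext a b; fin_cases a <;> fin_cases b <;> simp [Matrix.mul_apply, Fin.sum_univ_two]

lemma dg_eq (j : ℕ) (x : ℝ) : d.dg j x = dE (1000 - d.psi j x) := rfl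

lemma EE_succ (j n : ℕ) (x : ℝ) :
    d.EE j (n + 1) x = (1000 - d.psi j (x + n * α)) + d.EE j n x := by
  unfold EE
  rw [Finset.sum_range_succ]; push_cast; ring

lemma mid (A B P : Matrix (Fin 2) (Fin 2) ℝ) (j : ℕ) (x : ℝ) (Q : Matrix (Fin 2) (Fin 2) ℝ) :
    (A * P * (d.F j x).adjugate) * (d.F j x * Q * B) = A * (P * Q) * B := by
  have h : (A * P * (d.F j x).adjugate) * (d.F j x * Q * B) =
      A * P * ((d.F j x).adjugate * d.F j x) * Q * B := by simp only [Matrix.mul_assoc]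
  rw [h, d.F_adj]; simp only [Matrix.mul_assoc, Matrix.mul_one]

lemma iter_eq {A : ℝ → Matrix (Fin 2) (Fin 2) ℝ} (j n : ℕ) (x : ℝ)
    (h : ∀ l < n, A (x + (l : ℝ) * α) = d.DD j (x + (l : ℝ) * α)) :
    cocIter α A n x = d.F j (x + n * α) * dE (d.EE j n x) * (d.F j x).adjugate := by
  induction n with
  | zero =>
    have : dE (d.EE j 0 x) = 1 := by unfold dE EE; simp [Matrix.one_fin_two]
    rw [this]; simp [cocIter, d.F_adj']
  | succ n ih =>
    rw [cocIter, ih fun l hl => h l (by omega), h n (by omega), DD, d.mid, d.dg_eq, dE_mul,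
      ← d.EE_succ]
    congr 3; push_cast; ring

lemma iter_hit (j k m : ℕ) (x : ℝ) (hk : chi (d.N j) (x + (k : ℝ) * α) ≠ 0)
    (h1 : ∀ l < k, chi (d.N j) (x + (l : ℝ) * α) = 0)
    (h2 : ∀ l < m, chi (d.N j) (x + ((k + 1 + l : ℕ) : ℝ) * α) = 0) :
    cocIter α (d.AA j) (k + 1 + m) x = d.F j (x + ((k + 1 + m : ℕ) : ℝ) * α) *
      (dE (d.EE j m (x + ((k + 1 : ℕ) : ℝ) * α)) *
        (Qm (d.H j) (chi (d.N j) (x + (k : ℝ) * α)) * dE (d.EE j k x))) *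
        (d.F j x).adjugate := by
  rw [cocIter_add, cocIter, d.iter_eq j k x fun l hl => d.AA_nohit (h1 l hl), d.AA_Q hk, d.mid,
    d.iter_eq j m (x + ((k + 1 : ℕ) : ℝ) * α) fun l hl => ?_]
  · rw [show x + (k : ℝ) * α + α = x + ((k + 1 : ℕ) : ℝ) * α by push_cast; ring, d.mid]
    congr 3; push_cast; ring
  · refine d.AA_nohit ?_
    rw [← h2 l hl]; congr 1; push_cast; ring

lemma EE_le (j n : ℕ) (x : ℝ) : d.EE j n x ≤ 1000 * n := by
  unfold EE
  have : 0 ≤ ∑ l ∈ Finset.range n, d.psi j (x + l * α) :=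
    Finset.sum_nonneg fun l _ => d.psi_nonneg _ _
  linarith

lemma le_EE (j n : ℕ) (x : ℝ) : 999 * n - d.H j ≤ d.EE j n x := by
  unfold EE
  have := d.psi_sum_le j n x
  linarith

/-! periodicity -/

lemma G_per (j : ℕ) : Function.Periodic (d.G j) 1 := by
  intro x; unfold G; rw [chi_per]

lemma S_per (j k : ℕ) : Function.Periodic (d.S j k) 1 := by
  intro x; unfold S
  rw [d.G_per]
  congr 4
  refine Finset.sum_congr rfl fun l _ => ?_
  rw [add_right_comm, d.psi_per]

lemma T_per (j k : ℕ) : Function.Periodic (d.T j k) 1 := by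
  intro x; unfold T
  rw [d.G_per]
  congr 4
  refine Finset.sum_congr rfl fun l _ => ?_
  rw [add_sub_right_comm, d.psi_per]

lemma sig_per (j : ℕ) : Function.Periodic (d.sig j) 1 := by
  intro x; unfold sig
  refine Finset.sum_congr rfl fun l _ => ?_
  rw [add_sub_right_comm, d.S_per]

lemma tau_per (j : ℕ) : Function.Periodic (d.tau j) 1 := by
  intro x; unfold tau
  refine Finset.sum_congr rfl fun l _ => ?_
  rw [add_right_comm, d.T_per]

lemma F_per (j : ℕ) : Function.Periodic (d.F j) 1 := by
  induction j with
  | zero => intro x; rfl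
  | succ j ih => intro x; rw [F, F, ih, U, U, d.tau_per, d.sig_per]

lemma DD_per (j : ℕ) : Function.Periodic (d.DD j) 1 := by
  intro x; unfold DD dg a ai
  rw [add_right_comm, d.F_per, d.F_per, d.psi_per]

lemma AA_per (j : ℕ) : Function.Periodic (d.AA j) 1 := by
  intro x; unfold AA
  rw [d.DD_per, chi_per]

lemma DD_smooth (j : ℕ) : ContDiff ℝ (⊤ : ℕ∞) (d.DD j) := by
  obtain ⟨C, hC⟩ := d.DD_bdM 0 j
  exact hC.smooth

lemma DD_coc (j : ℕ) : Coc (d.DD j) := ⟨d.DD_per j, (d.DD_smooth j).continuous, d.DD_det j⟩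

lemma AA_smooth (j : ℕ) : ContDiff ℝ (⊤ : ℕ∞) (d.AA j) := by
  obtain ⟨w, hw, hw2⟩ := d.pert_bdM 0
  have h := (hw2 j).smooth.add (d.DD_smooth j)
  simpa using h

lemma AA_coc (j : ℕ) : Coc (d.AA j) := ⟨d.AA_per j, (d.AA_smooth j).continuous, d.AA_det j⟩

/-! lower bound -/

lemma F_abs_bdd (j : ℕ) : ∃ C : ℝ, ∀ x a b, |d.F j x a b| ≤ C := by
  obtain ⟨b, hb, hchi⟩ := chi_bdi 0
  exact ⟨_, fun x a c => (d.F_bdM hb hchi j a c).abs_le x⟩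

lemma F_bdd (j : ℕ) : ∃ C : ℝ, 1 ≤ C ∧ ∀ x, opNorm (d.F j x) ≤ C ∧
    opNorm (d.F j x).adjugate ≤ C := by
  obtain ⟨C, hC⟩ := d.F_abs_bdd j
  refine ⟨4 * C + 1, ?_, fun x => ⟨?_, ?_⟩⟩
  · have := (abs_nonneg _).trans (hC 0 0 0); linarith
  · have := opNorm_le (d.F j x)
    have := hC x 0 0; have := hC x 0 1; have := hC x 1 0; have := hC x 1 1
    linarith
  · have h := opNorm_le (d.F j x).adjugate
    rw [Matrix.adjugate_fin_two] at h ⊢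
    simp only [Matrix.of_apply, Matrix.cons_val', Matrix.cons_val_zero, Matrix.cons_val_one,
      Matrix.cons_val_fin_one, abs_neg] at h
    have := hC x 0 0; have := hC x 0 1; have := hC x 1 0; have := hC x 1 1
    linarith

lemma DD_lower (j : ℕ) : ∃ C : ℝ, ∀ n x, d.EE j n x - C ≤
    Real.log (opNorm (cocIter α (d.DD j) n x)) := by
  obtain ⟨C, hC1, hC⟩ := d.F_bdd j
  refine ⟨Real.log (C * C), fun n x => ?_⟩
  have h := d.iter_eq (A := d.DD j) j n x fun _ _ => rfl
  have h2 : dE (d.EE j n x) =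
      (d.F j (x + n * α)).adjugate * cocIter α (d.DD j) n x * d.F j x := by
    have : (d.F j (x + n * α)).adjugate * cocIter α (d.DD j) n x * d.F j x =
      ((d.F j (x + n * α)).adjugate * d.F j (x + n * α)) * dE (d.EE j n x) *
        ((d.F j x).adjugate * d.F j x) := by rw [h]; simp only [Matrix.mul_assoc]
    rw [this, d.F_adj, d.F_adj]; simp
  have h3 := abs_entry_le (dE (d.EE j n x)) 0 0
  have e : (dE (d.EE j n x)) 0 0 = Real.exp (d.EE j n x) := rfl
  rw [e, abs_of_pos (Real.exp_pos _), h2] at h3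
  have h4 : Real.exp (d.EE j n x) ≤ C * C * opNorm (cocIter α (d.DD j) n x) := by
    refine h3.trans ((opNorm_mul_le _ _).trans ?_)
    calc _ ≤ (C * opNorm (cocIter α (d.DD j) n x)) * C := by
          refine mul_le_mul ((opNorm_mul_le _ _).trans ?_) (hC _).1 (opNorm_nonneg _) ?_
          · exact mul_le_mul_of_nonneg_right (hC _).2 (opNorm_nonneg _)
          · exact mul_nonneg (by linarith) (opNorm_nonneg _)
      _ = _ := by ring
  have hp : 0 < opNorm (cocIter α (d.DD j) n x) := by
    have := half_le_opNorm _ (cocIter_det (α := α) (d.DD_coc j) n x)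
    linarith
  have h5 := Real.log_le_log (Real.exp_pos _) h4
  rw [Real.log_exp, Real.log_mul (by positivity) hp.ne'] at h5
  linarith

lemma int_EE (j n : ℕ) : (n : ℝ) * 999 ≤ ∫ x in (0 : ℝ)..1, d.EE j n x := by
  unfold EE
  have hc : ∀ l : ℕ, Continuous fun x : ℝ => d.psi j (x + l * α) := fun l =>
    cont_shift (d.psi_cont j) _
  rw [intervalIntegral.integral_sub (by simp)
    ((continuous_finsetSum _ fun l _ => hc l).intervalIntegrable _ _),
    intervalIntegral.integral_finsetSum fun l _ => (hc l).intervalIntegrable _ _,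
    Finset.sum_congr rfl fun (l : ℕ) _ => int_shift (d.psi_per j) ((l : ℝ) * α)]
  simp only [Finset.sum_const, Finset.card_range, nsmul_eq_mul, intervalIntegral.integral_const,
    smul_eq_mul]
  have := mul_le_mul_of_nonneg_left (d.int_psi j) (Nat.cast_nonneg (α := ℝ) n)
  linarith

lemma EE_cont (j n : ℕ) : Continuous (d.EE j n) := by
  unfold EE
  exact continuous_const.sub (continuous_finsetSum _ fun l _ => cont_shift (d.psi_cont j) _)

lemma DD_lint (j n : ℕ) (hn : n ≠ 0) : 999 ≤ lint α (d.DD j) n / n := by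
  obtain ⟨C, hC⟩ := d.DD_lower j
  refine le_lint_of_le (C := C) (d.DD_coc j) (fun n => ?_) n hn
  have h1 := intervalIntegral.integral_mono (a := 0) (b := 1) (μ := volume)
    (f := fun x => d.EE j n x - C)
    (g := fun x => Real.log (opNorm (cocIter α (d.DD j) n x))) (by norm_num)
    (((d.EE_cont j n).sub continuous_const).intervalIntegrable _ _)
    ((logc_cont (d.DD_coc j) _).intervalIntegrable _ _) (fun x => hC n x)
  rw [intervalIntegral.integral_sub ((d.EE_cont j n).intervalIntegrable _ _) (by simp)] at h1
  have h2 := d.int_EE j n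
  simp at h1
  unfold lint
  linarith

end Iter
end Dat

namespace Dat
section Upper

def rho (N : ℕ) (y : ℝ) : ℝ := max 0 (1 - 4 * N * |Real.sin (Real.pi * y)|)

lemma rho_nonneg (N : ℕ) (y : ℝ) : 0 ≤ rho N y := le_max_left _ _

lemma rho_le (N : ℕ) (y : ℝ) : rho N y ≤ 1 := by
  unfold rho
  refine max_le zero_le_one ?_
  have : 0 ≤ 4 * (N : ℝ) * |Real.sin (Real.pi * y)| := by positivity
  linarith

lemma rho_cont (N : ℕ) : Continuous (rho N) := by unfold rho; fun_prop

lemma rho_per (N : ℕ) : Function.Periodic (rho N) 1 := by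
  intro y; unfold rho
  rw [show Real.pi * (y + 1) = Real.pi * y + Real.pi by ring, Real.sin_add_pi, abs_neg]

lemma rho_ne {N : ℕ} (hN : 0 < N) {y : ℝ} (h : rho N y ≠ 0) : chi N y = 1 := by
  refine chi_one hN ?_
  have hN' : (0 : ℝ) < N := by exact_mod_cast hN
  by_contra hc
  push Not at hc
  apply h
  unfold rho
  refine max_eq_left ?_
  rw [div_lt_iff₀ (by positivity)] at hc
  linarith

lemma rho_int {N : ℕ} (hN : 0 < N) : 1 / (64 * (N : ℝ)) ≤ ∫ x in (0 : ℝ)..1, rho N x := by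
  have hN' : (1 : ℝ) ≤ N := by exact_mod_cast hN
  set t : ℝ := 1 / (32 * N) with ht
  have ht0 : 0 < t := by positivity
  have ht1 : t ≤ 1 := by rw [ht, div_le_one (by positivity)]; linarith
  have hi : ∀ a b, IntervalIntegrable (rho N) volume a b := fun a b =>
    (rho_cont N).intervalIntegrable a b
  rw [← intervalIntegral.integral_add_adjacent_intervals (hi 0 t) (hi t 1)]
  have h1 : 0 ≤ ∫ x in t..1, rho N x :=
    intervalIntegral.integral_nonneg ht1 fun x _ => rho_nonneg _ _
  have h2 : ∫ x in (0 : ℝ)..t, (1 / 2 : ℝ) ≤ ∫ x in (0 : ℝ)..t, rho N x := by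
    refine intervalIntegral.integral_mono_on ht0.le (by simp) (hi _ _) fun x hx => ?_
    refine le_trans ?_ (le_max_right _ _)
    have h3 : |Real.sin (Real.pi * x)| ≤ Real.pi * x := by
      have h4 : |Real.sin (Real.pi * x)| ≤ |Real.pi * x| := Real.abs_sin_le_abs
      rwa [abs_of_nonneg (mul_nonneg Real.pi_pos.le hx.1)] at h4
    have h5 : Real.pi * x ≤ 4 * t :=
      mul_le_mul Real.pi_le_four hx.2 hx.1 (by norm_num)
    have h6 : 4 * (N : ℝ) * |Real.sin (Real.pi * x)| ≤ 4 * N * (4 * t) :=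
      mul_le_mul_of_nonneg_left (h3.trans h5) (by positivity)
    have h7 : 4 * (N : ℝ) * (4 * t) = 1 / 2 := by rw [ht]; field_simp; norm_num
    linarith
  simp only [intervalIntegral.integral_const, smul_eq_mul, sub_zero] at h2
  have h8 : t * (1 / 2) = 1 / (64 * N) := by rw [ht]; field_simp; norm_num
  linarith

lemma mid_bound {H c E1 E2 X : ℝ} (hc0 : 0 ≤ c) (hc1 : c ≤ 1) (hH : 0 ≤ H)
    (h0 : c = 1 ∨ E2 + 1000 + E1 ≤ X) (h1 : E2 + 1000 - E1 ≤ X) (h2 : -E2 - 1000 + E1 ≤ X)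
    (h3 : H - E1 - E2 - 1000 ≤ X) :
    opNorm (dE E2 * (Qm H c * dE E1)) ≤ 8 * Real.exp X := by
  refine (opNorm_le _).trans ?_
  have e00 : (dE E2 * (Qm H c * dE E1)) 0 0 = Real.exp (E2 + 1000 + E1 - H) * (1 - c) := by
    rw [Real.exp_sub, Real.exp_add, Real.exp_add, div_eq_mul_inv, ← Real.exp_neg]
    simp [dE, Qm, Matrix.mul_apply, Fin.sum_univ_two]; ring
  have e01 : (dE E2 * (Qm H c * dE E1)) 0 1 = -(Real.exp (E2 + 1000 - E1) * c) := by
    rw [sub_eq_add_neg, Real.exp_add, Real.exp_add]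
    simp [dE, Qm, Matrix.mul_apply, Fin.sum_univ_two]; ring
  have e10 : (dE E2 * (Qm H c * dE E1)) 1 0 = Real.exp (-E2 - 1000 + E1) * c := by
    rw [sub_eq_add_neg, Real.exp_add, Real.exp_add]
    simp [dE, Qm, Matrix.mul_apply, Fin.sum_univ_two]; ring
  have e11 : (dE E2 * (Qm H c * dE E1)) 1 1 = Real.exp (H - E1 - E2 - 1000) * (1 + c) := by
    rw [sub_eq_add_neg, sub_eq_add_neg, sub_eq_add_neg, Real.exp_add, Real.exp_add, Real.exp_add]
    simp [dE, Qm, Matrix.mul_apply, Fin.sum_univ_two]; ring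
  have hX := Real.exp_pos X
  rw [e00, e01, e10, e11, abs_neg, abs_mul, abs_mul, abs_mul, abs_mul, Real.abs_exp, Real.abs_exp,
    Real.abs_exp, Real.abs_exp, abs_of_nonneg hc0, abs_of_nonneg (by linarith : 0 ≤ 1 - c),
    abs_of_nonneg (by linarith : 0 ≤ 1 + c)]
  have b0 : Real.exp (E2 + 1000 + E1 - H) * (1 - c) ≤ Real.exp X * 1 := by
    rcases h0 with h0 | h0
    · rw [h0]; simp; exact hX.le
    · exact mul_le_mul (Real.exp_le_exp.2 (by linarith)) (by linarith) (by linarith) hX.le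
  have b1 : Real.exp (E2 + 1000 - E1) * c ≤ Real.exp X * 1 :=
    mul_le_mul (Real.exp_le_exp.2 h1) hc1 hc0 hX.le
  have b2 : Real.exp (-E2 - 1000 + E1) * c ≤ Real.exp X * 1 :=
    mul_le_mul (Real.exp_le_exp.2 h2) hc1 hc0 hX.le
  have b3 : Real.exp (H - E1 - E2 - 1000) * (1 + c) ≤ Real.exp X * 2 :=
    mul_le_mul (Real.exp_le_exp.2 h3) (by linarith) (by linarith) hX.le
  linarith

lemma dE_bound {E X : ℝ} (h1 : E ≤ X) (h2 : -E ≤ X) : opNorm (dE E) ≤ 8 * Real.exp X := by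
  refine (opNorm_le _).trans ?_
  have hX := Real.exp_pos X
  have e1 := Real.exp_le_exp.2 h1
  have e2 := Real.exp_le_exp.2 h2
  simp [dE]
  linarith

variable {α : ℝ} (d : Dat α)

lemma FPF_bound {j : ℕ} (hF : ∀ x a b, |d.F j x a b| ≤ Real.exp (d.N j / 250))
    {P A : Matrix (Fin 2) (Fin 2) ℝ} {X x y : ℝ} (hP : opNorm P ≤ 8 * Real.exp X)
    (hA : A = d.F j y * P * (d.F j x).adjugate) (hdet : A.det = 1) :
    Real.log (opNorm A) ≤ X + d.N j / 125 + 5 := by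
  set f := Real.exp (d.N j / 250 : ℝ) with hf
  have hf0 : 0 < f := Real.exp_pos _
  have h1 : opNorm (d.F j y) ≤ 4 * f := by
    have := opNorm_le (d.F j y)
    have := hF y 0 0; have := hF y 0 1; have := hF y 1 0; have := hF y 1 1
    linarith
  have h2 : opNorm (d.F j x).adjugate ≤ 4 * f := by
    have h := opNorm_le (d.F j x).adjugate
    rw [Matrix.adjugate_fin_two] at h ⊢
    simp only [Matrix.of_apply, Matrix.cons_val', Matrix.cons_val_zero, Matrix.cons_val_one,
      Matrix.cons_val_fin_one, abs_neg] at h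
    have := hF x 0 0; have := hF x 0 1; have := hF x 1 0; have := hF x 1 1
    linarith
  have h3 : opNorm A ≤ 128 * Real.exp (X + d.N j / 125) := by
    rw [hA]
    refine (opNorm_mul_le _ _).trans ?_
    calc _ ≤ (4 * f * (8 * Real.exp X)) * (4 * f) := by
          refine mul_le_mul ((opNorm_mul_le _ _).trans ?_) h2 (opNorm_nonneg _) (by positivity)
          exact mul_le_mul h1 hP (opNorm_nonneg _) (by positivity)
      _ = 128 * (Real.exp X * (f * f)) := by ring
      _ = _ := by
        rw [hf, ← Real.exp_add, ← Real.exp_add]; congr 3; ring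
  have hp := half_le_opNorm A hdet
  have h4 := Real.log_le_log (by linarith) h3
  rw [Real.log_mul (by norm_num) (Real.exp_pos _).ne', Real.log_exp] at h4
  have h5 : Real.log 128 = 7 * Real.log 2 := by
    rw [show (128 : ℝ) = 2 ^ 7 by norm_num, Real.log_pow]; norm_num
  have := Real.log_two_lt_d9
  linarith

def WW (n : ℕ) : Finset ℕ := Finset.Icc ((n + 3) / 4) (3 * n / 4)

lemma pw {j : ℕ} (hF : ∀ x a b, |d.F j x a b| ≤ Real.exp (d.N j / 250)) (x : ℝ) :
    Real.log (opNorm (cocIter α (d.AA j) (d.N j) x)) ≤ 1000.02 * d.N j + 5 -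
      400 * d.N j * ∑ k ∈ WW (d.N j), rho (d.N j) (x + k * α) := by
  have hdet := cocIter_det (α := α) (d.AA_coc j) (d.N j) x
  have hN := d.N_geR j
  have hH := d.H_le j
  have hH0 := d.H_nonneg j
  have hWlt : ∀ k ∈ WW (d.N j), k < d.N j := by
    intro k hk
    have := Finset.mem_Icc.1 hk
    have := d.N_ge j
    omega
  by_cases hit : ∃ k < d.N j, chi (d.N j) (x + (k : ℝ) * α) ≠ 0
  · obtain ⟨k, hk, hkc⟩ := hit
    have hz : ∀ l < d.N j, l ≠ k → chi (d.N j) (x + (l : ℝ) * α) = 0 := by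
      intro l hl hlk
      by_contra hc
      have := d.chi_uniq (j := j) (x := x) (a := l) (b := k) (by rw [abs_lt]; omega)
        (by exact_mod_cast hc) (by exact_mod_cast hkc)
      omega
    obtain ⟨m, hm⟩ : ∃ m, d.N j = k + 1 + m := ⟨d.N j - (k + 1), by omega⟩
    have hit := d.iter_hit j k m x hkc (fun l hl => hz l (by omega) (by omega))
      (fun l hl => hz _ (by omega) (by omega))
    rw [← hm] at hit
    have c0 := chi_nonneg (d.N j) (x + (k : ℝ) * α)
    have c1 := chi_le_one (d.N j) (x + (k : ℝ) * α)
    have u1 := d.EE_le j k x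
    have l1 := d.le_EE j k x
    have u2 := d.EE_le j m (x + ((k + 1 : ℕ) : ℝ) * α)
    have l2 := d.le_EE j m (x + ((k + 1 : ℕ) : ℝ) * α)
    have hmR : (d.N j : ℝ) = k + 1 + m := by exact_mod_cast hm
    have hk0 : (0 : ℝ) ≤ k := Nat.cast_nonneg _
    have hm0 : (0 : ℝ) ≤ m := Nat.cast_nonneg _
    have hz' : ∀ l ∈ WW (d.N j), l ≠ k → rho (d.N j) (x + (l : ℝ) * α) = 0 := by
      intro l hl hlk
      by_contra hc
      have h1 := rho_ne (d.N_pos j) hc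
      rw [hz l (hWlt l hl) hlk] at h1
      norm_num at h1
    by_cases hg : k ∈ WW (d.N j) ∧ chi (d.N j) (x + (k : ℝ) * α) = 1
    · have hs : ∑ k ∈ WW (d.N j), rho (d.N j) (x + k * α) ≤ 1 := by
        rw [Finset.sum_eq_single_of_mem k hg.1 hz']
        exact rho_le _ _
      have hs2 := mul_le_mul_of_nonneg_left hs (by positivity : (0 : ℝ) ≤ 400 * d.N j)
      have hW := Finset.mem_Icc.1 hg.1
      have k1 : (d.N j : ℝ) ≤ 4 * k := by
        have : d.N j ≤ 4 * k := by omega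
        exact_mod_cast this
      have k2 : 4 * (k : ℝ) ≤ 3 * d.N j := by
        have : 4 * k ≤ 3 * d.N j := by omega
        exact_mod_cast this
      have := d.FPF_bound hF (mid_bound (X := 600 * d.N j + 3 * d.H j) c0 c1 hH0 (Or.inl hg.2)
        (by linarith) (by linarith) (by linarith)) hit hdet
      linarith
    · have hs : ∑ k ∈ WW (d.N j), rho (d.N j) (x + k * α) = 0 := by
        refine Finset.sum_eq_zero fun l hl => ?_
        by_cases hlk : l = k
        · by_contra hc
          have h1 := rho_ne (d.N_pos j) hc
          rw [hlk] at h1 hl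
          exact hg ⟨hl, h1⟩
        · exact hz' l hl hlk
      rw [hs]
      have := d.FPF_bound hF (mid_bound (X := 1000 * d.N j + 3 * d.H j) c0 c1 hH0
        (Or.inr (by linarith)) (by linarith) (by linarith) (by linarith)) hit hdet
      linarith
  · push Not at hit
    have hs : ∑ k ∈ WW (d.N j), rho (d.N j) (x + k * α) = 0 := by
      refine Finset.sum_eq_zero fun l hl => ?_
      by_contra hc
      have h1 := rho_ne (d.N_pos j) hc
      rw [hit l (hWlt l hl)] at h1
      norm_num at h1
    have e := d.iter_eq (A := d.AA j) j (d.N j) x fun l hl => d.AA_nohit (hit l hl)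
    have u1 := d.EE_le j (d.N j) x
    have l1 := d.le_EE j (d.N j) x
    have := d.FPF_bound hF (dE_bound (X := 1000 * d.N j + 3 * d.H j) (by linarith)
      (by linarith)) e hdet
    rw [hs]
    linarith

lemma AA_lyap {j : ℕ} (hF : ∀ x a b, |d.F j x a b| ≤ Real.exp (d.N j / 250)) :
    lyap α (d.AA j) ≤ 998.5 := by
  have hN := d.N_geR j
  have hN0 := d.N_pos j
  refine (lyap_le (d.AA_coc j) hN0.ne').trans ?_
  rw [div_le_iff₀ (by linarith)]
  have hc : ∀ l : ℕ, Continuous fun x : ℝ => rho (d.N j) (x + l * α) := fun l =>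
    cont_shift (rho_cont _) _
  have hcs : Continuous fun x : ℝ => ∑ k ∈ WW (d.N j), rho (d.N j) (x + k * α) :=
    continuous_finsetSum _ fun l _ => hc l
  have h1 := intervalIntegral.integral_mono (a := 0) (b := 1) (μ := volume)
    (f := fun x => Real.log (opNorm (cocIter α (d.AA j) (d.N j) x)))
    (g := fun x => 1000.02 * d.N j + 5 -
      400 * d.N j * ∑ k ∈ WW (d.N j), rho (d.N j) (x + k * α)) (by norm_num)
    ((logc_cont (d.AA_coc j) _).intervalIntegrable _ _)
    ((continuous_const.sub (continuous_const.mul hcs)).intervalIntegrable _ _)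
    (fun x => d.pw hF x)
  have hcs2 : Continuous fun x : ℝ => 400 * (d.N j : ℝ) *
      ∑ k ∈ WW (d.N j), rho (d.N j) (x + k * α) := continuous_const.mul hcs
  rw [intervalIntegral.integral_sub (by simp)
    (hcs2.intervalIntegrable _ _),
    intervalIntegral.integral_const_mul,
    intervalIntegral.integral_finsetSum fun l _ => (hc l).intervalIntegrable _ _,
    Finset.sum_congr rfl fun (l : ℕ) _ => int_shift (rho_per (d.N j)) ((l : ℝ) * α)] at h1
  simp only [Finset.sum_const, nsmul_eq_mul, intervalIntegral.integral_const,
    smul_eq_mul, sub_zero, one_mul] at h1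
  have hcard : (d.N j : ℝ) / 4 ≤ (WW (d.N j)).card := by
    have : d.N j ≤ 4 * (WW (d.N j)).card := by
      have := d.N_ge j
      unfold WW; rw [Nat.card_Icc]; omega
    have : (d.N j : ℝ) ≤ 4 * (WW (d.N j)).card := by exact_mod_cast this
    linarith
  have h2 : (d.N j : ℝ) / 4 * (1 / (64 * d.N j)) ≤
      (WW (d.N j)).card * ∫ x in (0 : ℝ)..1, rho (d.N j) x :=
    mul_le_mul hcard (rho_int hN0) (by positivity) (by positivity)
  have h3 : (d.N j : ℝ) / 4 * (1 / (64 * d.N j)) = 1 / 256 := by field_simp; norm_num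
  rw [h3] at h2
  have h4 := mul_le_mul_of_nonneg_left h2 (by positivity : (0 : ℝ) ≤ 400 * d.N j)
  unfold lint
  linarith

end Upper

section Final

lemma final {α : ℝ} (d : Dat α) : ∃ D : ℝ → Matrix (Fin 2) (Fin 2) ℝ, ∃ A : ℕ → ℝ → Matrix (Fin 2) (Fin 2) ℝ,
      Function.Periodic D 1 ∧ ContDiff ℝ (⊤ : ℕ∞) D ∧ (∀ x, (D x).det = 1) ∧
      (∀ j, Function.Periodic (A j) 1 ∧ ContDiff ℝ (⊤ : ℕ∞) (A j) ∧
        ∀ x, ((A j) x).det = 1) ∧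
      0 < lyap α D ∧
      (∀ k : ℕ, Tendsto (fun j : ℕ => cNorm k (fun x => A j x - D x)) atTop (nhds 0)) ∧
      limsup (fun j : ℕ => lyap α (A j)) atTop < lyap α D := by
  obtain ⟨D, hD⟩ := d.DD_limit
  obtain ⟨w, hw, hwD⟩ := hD 0
  have hsm : ContDiff ℝ (⊤ : ℕ∞) D := by
    have h := (d.DD_smooth 0).sub (hwD 0).smooth
    simpa using h
  have hent : ∀ x a b, Tendsto (fun j => d.DD j x a b) atTop (nhds (D x a b)) := by
    intro x a b
    rw [tendsto_iff_norm_sub_tendsto_zero]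
    refine squeeze_zero (fun _ => norm_nonneg _) (fun j => ?_) hw
    exact ((hwD j) a b).abs_le x
  have hlim : ∀ x, Tendsto (fun j => d.DD j x) atTop (nhds (D x)) := by
    intro x
    exact tendsto_pi_nhds.2 fun a => tendsto_pi_nhds.2 fun b => hent x a b
  have hper : Function.Periodic D 1 := by
    intro x
    refine tendsto_nhds_unique (hlim (x + 1)) ?_
    simp only [d.DD_per _ x]
    exact hlim x
  have hdet : ∀ x, (D x).det = 1 := by
    intro x
    have h1 : Tendsto (fun j => (d.DD j x).det) atTop (nhds (D x).det) := by
      simp only [Matrix.det_fin_two]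
      exact ((hent x 0 0).mul (hent x 1 1)).sub ((hent x 0 1).mul (hent x 1 0))
    simp only [d.DD_det] at h1
    exact tendsto_nhds_unique h1 tendsto_const_nhds
  have hcoc : Coc D := ⟨hper, hsm.continuous, hdet⟩
  have hbd : ∃ C : ℝ, 1 ≤ C ∧ ∀ j x, opNorm (d.DD j x) ≤ C := by
    obtain ⟨C0, hC0⟩ := d.DD_bdM 0 0
    obtain ⟨W, hW⟩ := hw.bddAbove_range
    have hW' : ∀ j, w j ≤ W := fun j => hW ⟨j, rfl⟩
    have key : ∀ j, BdM 0 (w j + (w 0 + C0)) (d.DD j) := by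
      intro j
      have h := (hwD j).add ((hC0.sub (hwD 0)))
      have e : (fun x => (d.DD j x - D x) + (d.DD 0 x - (d.DD 0 x - D x))) = d.DD j := by
        funext x; abel
      rw [e] at h
      exact h.mono (by linarith)
    refine ⟨max 1 (4 * (W + (W + C0))), le_max_left _ _, fun j x => ?_⟩
    refine ((key j).opNorm_le x).trans (le_trans ?_ (le_max_right _ _))
    have := hW' j; have := hW' 0
    linarith
  have hL : 999 ≤ lyap α D := lyap_limit d.DD_coc hcoc hlim hbd d.DD_lint
  refine ⟨D, d.AA, hper, hsm, hdet, fun j => ⟨d.AA_per j, d.AA_smooth j, d.AA_det j⟩,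
    by linarith, fun k => ?_, ?_⟩
  · obtain ⟨v, hv, hv2⟩ := hD k
    obtain ⟨u, hu, hu2⟩ := d.pert_bdM k
    have hs : Tendsto (fun j => u j + v j) atTop (nhds 0) := by simpa using hu.add hv
    refine squeeze_zero (fun _ => cNorm_nonneg) (fun j => ?_) hs
    have h := (hu2 j).add (hv2 j)
    have e : (fun x => (d.AA j x - d.DD j x) + (d.DD j x - D x)) = fun x => d.AA j x - D x := by
      funext x; abel
    rw [e] at h
    exact h.cNorm_le
  · refine lt_of_le_of_lt (b := (998.5 : ℝ)) ?_ (by linarith)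
    refine limsup_le_of_le ?_ ?_
    · exact IsBoundedUnder.isCoboundedUnder_le
        ⟨-1, eventually_map.2 (Eventually.of_forall fun j => neg_one_le_lyap (d.AA_coc j))⟩
    · filter_upwards [d.F_sup] with j hj using d.AA_lyap hj

end Final
end Dat

/-- Discontinuity of the Lyapunov exponent in `C^∞(S¹, SL(2,ℝ))` for any fixed Brjuno
frequency `α` (i.e. `limsup (log q_{n+1})/q_n^δ < ∞` for some `0 < δ < 1`): there are
`D` with `L(α,D) > 0` and `A_j → D` in every `C^k` norm with
`limsup_j L(α,A_j) < L(α,D)`. -/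
theorem statement1 (α : ℝ) (hα : Irrational α)
    (hBrjuno : ∃ δ : ℝ, 0 < δ ∧ δ < 1 ∧ ∃ β : ℝ, ∀ᶠ n in atTop,
      Real.log (cfq α (n + 1) : ℝ) ≤ β * (cfq α n : ℝ) ^ δ) :
    ∃ D : ℝ → Matrix (Fin 2) (Fin 2) ℝ, ∃ A : ℕ → ℝ → Matrix (Fin 2) (Fin 2) ℝ,
      Function.Periodic D 1 ∧ ContDiff ℝ (⊤ : ℕ∞) D ∧ (∀ x, (D x).det = 1) ∧
      (∀ j, Function.Periodic (A j) 1 ∧ ContDiff ℝ (⊤ : ℕ∞) (A j) ∧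
        ∀ x, ((A j) x).det = 1) ∧
      0 < lyap α D ∧
      (∀ k : ℕ, Tendsto (fun j : ℕ => cNorm k (fun x => A j x - D x)) atTop (nhds 0)) ∧
      limsup (fun j : ℕ => lyap α (A j)) atTop < lyap α D := by
  obtain ⟨d⟩ := dat_exists hα hBrjuno
  exact d.final
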